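/- arXiv:2402.16984 — 6 statements merged into one kernel-verified Lean document; each statement's English description precedes it below -/
import Mathlib

section
/- For every integer r ≥ 3 there exist a constant C_r > 0 and integers Δ₀ = Δ₀(r) and n₀ = n₀(r) such that: if G is an r-uniform hypergraph on n ≥ n₀ vertices with maximum degree Δ(G) = Δ ≥ Δ₀, then θ̃(G) ≤ C_r · Δ³ · log n. -/
/-- The degree of a vertex `v` in a hypergraph with edge set `G`:
the number of edges containing `v`. -/
def hyperDegree {V : Type*} [DecidableEq V] (G : Finset (Finset V)) (v : V) : ℕ :=
  (G.filter fun e => v ∈ e).card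

/-- The maximum degree `Δ(G)` of a hypergraph with edge set `G`. -/
def maxDegree {V : Type*} [DecidableEq V] [Fintype V] (G : Finset (Finset V)) : ℕ :=
  Finset.univ.sup (hyperDegree G)

/-- A set of cardinality `t` (modeled as `Fin t`) `k`-represents an `r`-uniform hypergraph
with edge set `G`: there is a family `(S_v)` of subsets of `Fin t` such that an `r`-set of
vertices is an edge iff the intersection of the corresponding sets has at least `k` elements. -/
def KRepresents {V : Type*} [DecidableEq V] (r k t : ℕ) (G : Finset (Finset V)) : Prop :=
  ∃ S : V → Finset (Fin t),
    ∀ e : Finset V, e.card = r → (e ∈ G ↔ k ≤ (e.inf S).card)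

/-- `θ̃(G) = min_{k ≥ 1} θ_k(G)`: the smallest cardinality `t` of a set that
`k`-represents `G` for some positive integer `k`. -/
noncomputable def thetaTilde {V : Type*} [DecidableEq V] (r : ℕ) (G : Finset (Finset V)) : ℕ :=
  sInf {t | ∃ k : ℕ, 1 ≤ k ∧ KRepresents r k t G}

open Finset in
/-- The moment generating function of a binomial count, as a sum over a finite product space. -/
lemma sum_pow_card_filter {Ω : Type*} [Fintype Ω] (P : Ω → Prop) [DecidablePred P]
    (t : ℕ) (x : ℝ) :
    ∑ ω : Fin t → Ω, x ^ #{j | P (ω j)} =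
      ((Fintype.card Ω : ℝ) + (x - 1) * #{a | P a}) ^ t := by
  have base : ∑ a : Ω, (if P a then x else 1) =
      (Fintype.card Ω : ℝ) + (x - 1) * #{a | P a} := by
    have h (a : Ω) : (if P a then x else 1) = 1 + (x - 1) * (if P a then 1 else 0) := by
      split_ifs <;> ring
    simp only [h, sum_add_distrib, ← mul_sum, sum_boole]
    simp
  rw [← base, Fintype.sum_pow]
  refine sum_congr rfl fun ω _ => ?_
  rw [prod_ite]
  simp

open Finset in
/-- An event of density at most `1 / (4 Q)` rarely occurs `k` times in `2 k Q` trials. -/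
lemma card_le_count_le {Ω : Type*} [Fintype Ω] (P : Ω → Prop) [DecidablePred P]
    (k Q : ℕ) (hQ : 0 < Q) (hP : 4 * Q * #{a | P a} ≤ Fintype.card Ω) :
    (#{ω : Fin (2 * k * Q) → Ω | k ≤ #{j | P (ω j)}} : ℝ) ≤
      (Fintype.card Ω : ℝ) ^ (2 * k * Q) * Real.exp (-(k / 6)) := by
  have hQ' : (0 : ℝ) < Q := by exact_mod_cast hQ
  have hP' : 4 * (Q : ℝ) * #{a | P a} ≤ Fintype.card Ω := by exact_mod_cast hP
  have markov : (#{ω : Fin (2 * k * Q) → Ω | k ≤ #{j | P (ω j)}} : ℝ) * 2 ^ k ≤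
      ∑ ω : Fin (2 * k * Q) → Ω, (2 : ℝ) ^ #{j | P (ω j)} := by
    rw [← nsmul_eq_mul]
    refine (card_nsmul_le_sum _ _ _ fun ω hω => ?_).trans
      (sum_le_sum_of_subset_of_nonneg (filter_subset _ _) fun _ _ _ => by positivity)
    exact pow_le_pow_right₀ one_le_two (mem_filter.1 hω).2
  rw [sum_pow_card_filter] at markov
  have step : (Fintype.card Ω : ℝ) + (2 - 1) * #{a | P a} ≤
      Fintype.card Ω * Real.exp (1 / (4 * Q)) := by
    have h1 : (#{a | P a} : ℝ) ≤ Fintype.card Ω * (1 / (4 * Q)) := by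
      rw [mul_one_div, le_div_iff₀ (by positivity)]
      linarith
    have h2 := Real.add_one_le_exp (1 / (4 * (Q : ℝ)))
    nlinarith [mul_le_mul_of_nonneg_left h2 (Nat.cast_nonneg (α := ℝ) (Fintype.card Ω))]
  have bound := markov.trans (pow_le_pow_left₀ (by positivity) step _)
  rw [mul_pow, ← Real.exp_nat_mul] at bound
  have hexp : ((2 * k * Q : ℕ) : ℝ) * (1 / (4 * Q)) = k / 2 := by
    push_cast
    field_simp
    ring
  rw [hexp] at bound
  have htwo : Real.exp (k / 2) ≤ Real.exp (-(k / 6)) * 2 ^ k := by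
    rw [← Real.rpow_natCast 2 k, Real.rpow_def_of_pos two_pos, ← Real.exp_add]
    apply Real.exp_le_exp.2
    nlinarith [Real.log_two_gt_d9, Nat.cast_nonneg (α := ℝ) k]
  refine le_of_mul_le_mul_right (bound.trans ?_) (by positivity : (0 : ℝ) < 2 ^ k)
  exact (mul_le_mul_of_nonneg_left htwo (by positivity)).trans_eq (mul_assoc _ _ _).symm

open Finset in
/-- An event of density at least `1 / Q` rarely occurs fewer than `k` times in `2 k Q` trials. -/
lemma card_count_lt_le {Ω : Type*} [Fintype Ω] (P : Ω → Prop) [DecidablePred P]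
    (k Q : ℕ) (hQ : 0 < Q) (hP : Fintype.card Ω ≤ Q * #{a | P a}) :
    (#{ω : Fin (2 * k * Q) → Ω | #{j | P (ω j)} < k} : ℝ) ≤
      (Fintype.card Ω : ℝ) ^ (2 * k * Q) * Real.exp (-(k / 6)) := by
  have hQ' : (0 : ℝ) < Q := by exact_mod_cast hQ
  have hP' : (Fintype.card Ω : ℝ) ≤ Q * #{a | P a} := by exact_mod_cast hP
  have hle : (#{a | P a} : ℝ) ≤ Fintype.card Ω := by exact_mod_cast card_le_univ _
  have markov : (#{ω : Fin (2 * k * Q) → Ω | #{j | P (ω j)} < k} : ℝ) * (1 / 2) ^ k ≤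
      ∑ ω : Fin (2 * k * Q) → Ω, (1 / 2 : ℝ) ^ #{j | P (ω j)} := by
    rw [← nsmul_eq_mul]
    refine (card_nsmul_le_sum _ _ _ fun ω hω => ?_).trans
      (sum_le_sum_of_subset_of_nonneg (filter_subset _ _) fun _ _ _ => by positivity)
    exact pow_le_pow_of_le_one (by norm_num) (by norm_num) (mem_filter.1 hω).2.le
  rw [sum_pow_card_filter] at markov
  have step : (Fintype.card Ω : ℝ) + (1 / 2 - 1) * #{a | P a} ≤
      Fintype.card Ω * Real.exp (-(1 / (2 * Q))) := by
    have h1 : Fintype.card Ω * (1 / (2 * (Q : ℝ))) ≤ #{a | P a} / 2 := by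
      rw [mul_one_div, div_le_iff₀ (by positivity)]
      linarith
    have h2 := Real.one_sub_le_exp_neg (1 / (2 * (Q : ℝ)))
    nlinarith [mul_le_mul_of_nonneg_left h2 (Nat.cast_nonneg (α := ℝ) (Fintype.card Ω))]
  have bound := markov.trans (pow_le_pow_left₀ (by linarith) step _)
  rw [mul_pow, ← Real.exp_nat_mul] at bound
  have hexp : ((2 * k * Q : ℕ) : ℝ) * (-(1 / (2 * Q))) = -k := by
    push_cast
    field_simp
  rw [hexp] at bound
  have htwo : Real.exp (-k) ≤ Real.exp (-(k / 6)) * (1 / 2) ^ k := by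
    rw [← Real.rpow_natCast (1 / 2) k, Real.rpow_def_of_pos (by norm_num), ← Real.exp_add]
    apply Real.exp_le_exp.2
    rw [one_div, Real.log_inv]
    nlinarith [Real.log_two_lt_d9, Nat.cast_nonneg (α := ℝ) k]
  refine le_of_mul_le_mul_right (bound.trans ?_) (by positivity : (0 : ℝ) < (1 / 2) ^ k)
  exact (mul_le_mul_of_nonneg_left htwo (by positivity)).trans_eq (mul_assoc _ _ _).symm

open Finset in
/-- Given events of density at least `1 / Q` (indexed by `G`) or at most `1 / (4 Q)`, some
sequence of `2 k Q` sample points separates the two kinds by the number of occurrences. -/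
lemma exists_separating_sample {Ω ι : Type*} [Fintype Ω] [Nonempty Ω] [DecidableEq ι]
    (P : ι → Ω → Prop) [∀ i, DecidablePred (P i)] (F G : Finset ι) (k Q : ℕ) (hQ : 0 < Q)
    (hG : ∀ i ∈ F, i ∈ G → Fintype.card Ω ≤ Q * #{a | P i a})
    (hnG : ∀ i ∈ F, i ∉ G → 4 * Q * #{a | P i a} ≤ Fintype.card Ω)
    (hk : (#F : ℝ) * Real.exp (-(k / 6)) < 1) :
    ∃ ω : Fin (2 * k * Q) → Ω, ∀ i ∈ F, (i ∈ G ↔ k ≤ #{j | P i (ω j)}) := by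
  classical
  by_contra! hcon
  let bad (i : ι) : Finset (Fin (2 * k * Q) → Ω) :=
    univ.filter fun ω => ¬(i ∈ G ↔ k ≤ #{j | P i (ω j)})
  have hbad : ∀ i ∈ F, (#(bad i) : ℝ) ≤
      (Fintype.card Ω : ℝ) ^ (2 * k * Q) * Real.exp (-(k / 6)) := by
    intro i hi
    by_cases hiG : i ∈ G
    · simpa [bad, hiG] using card_count_lt_le (P i) k Q hQ (hG i hi hiG)
    · simpa [bad, hiG] using card_le_count_le (P i) k Q hQ (hnG i hi hiG)
  have hcover : (univ : Finset (Fin (2 * k * Q) → Ω)) ⊆ F.biUnion bad := by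
    intro ω _
    obtain ⟨i, hi, h⟩ := hcon ω
    refine mem_biUnion.2 ⟨i, hi, mem_filter.2 ⟨mem_univ _, ?_⟩⟩
    rcases h with ⟨h1, h2⟩ | ⟨h1, h2⟩
    · exact fun h => absurd (h.1 h1) (not_le.2 h2)
    · exact fun h => h1 (h.2 h2)
  have hcard : ((Fintype.card Ω : ℝ)) ^ (2 * k * Q) ≤
      #F * ((Fintype.card Ω : ℝ) ^ (2 * k * Q) * Real.exp (-(k / 6))) := by
    have h := (card_le_card hcover).trans card_biUnion_le
    rw [card_univ, Fintype.card_fun, Fintype.card_fin] at h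
    rw [← nsmul_eq_mul]
    refine le_trans ?_ (sum_le_card_nsmul F (fun i => (#(bad i) : ℝ)) _ hbad)
    exact_mod_cast h
  have hpos : (0 : ℝ) < (Fintype.card Ω : ℝ) ^ (2 * k * Q) := by
    have : 0 < Fintype.card Ω := Fintype.card_pos
    positivity
  nlinarith

open Finset in
lemma card_le_mul_card_apply_eq_zero {α : Type*} [Fintype α] [DecidableEq α] (Q : ℕ) [NeZero Q]
    (a : α) : Fintype.card (α → Fin Q) ≤ Q * #{f : α → Fin Q | f a = 0} := by
  have h : Q * #{f : α → Fin Q | f a = 0} =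
      #(univ.filter (fun f : α → Fin Q => f a = 0) ×ˢ (univ : Finset (Fin Q))) := by
    rw [card_product, card_univ, Fintype.card_fin, mul_comm]
  rw [← card_univ, h]
  refine card_le_card_of_injOn (fun f => (Function.update f a 0, f a)) ?_ ?_
  · intro f _
    simp
  · intro f _ g _ h
    simp only [Prod.mk.injEq] at h
    funext b
    by_cases hb : b = a
    · rw [hb, h.2]
    · simpa [hb] using congrFun h.1 b

open Finset in
lemma card_apply_eq_zero_pair_mul_le {α : Type*} [Fintype α] [DecidableEq α] (Q : ℕ) [NeZero Q]
    {a b : α} (hab : a ≠ b) :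
    #{f : α → Fin Q | f a = 0 ∧ f b = 0} * (Q * Q) ≤ Fintype.card (α → Fin Q) := by
  have h : #{f : α → Fin Q | f a = 0 ∧ f b = 0} * (Q * Q) =
      #(univ.filter (fun f : α → Fin Q => f a = 0 ∧ f b = 0) ×ˢ
        ((univ : Finset (Fin Q)) ×ˢ (univ : Finset (Fin Q)))) := by
    rw [card_product, card_product, card_univ, Fintype.card_fin]
  rw [← card_univ, h]
  refine card_le_card_of_injOn
    (fun p => Function.update (Function.update p.1 a p.2.1) b p.2.2) (fun _ _ => by simp) ?_
  rintro ⟨f, i, j⟩ hf ⟨g, i', j'⟩ hg h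
  simp only [coe_product, Set.mem_prod, mem_coe, mem_filter, mem_univ, true_and, and_true]
    at hf hg h
  have hi : i = i' := by simpa [hab] using congrFun h a
  have hj : j = j' := by simpa using congrFun h b
  have hfg : f = g := by
    funext c
    by_cases ha : c = a
    · rw [ha, hf.1, hg.1]
    by_cases hb : c = b
    · rw [hb, hf.2, hg.2]
    simpa [ha, hb] using congrFun h c
  rw [hi, hj, hfg]

open Finset in
/-- The vertices covered by the edges selected by `f`, that is, those `e ∈ G` with `f e = 0`. -/
def selectedCover {V : Type*} [DecidableEq V] {Q : ℕ} [NeZero Q] (G : Finset (Finset V))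
    (f : Finset V → Fin Q) : Finset V :=
  (G.filter fun e => f e = 0).biUnion id

open Finset in
lemma card_le_mul_card_subset_selectedCover {V : Type*} [DecidableEq V] [Fintype V] {Q : ℕ}
    [NeZero Q] (G : Finset (Finset V)) {e : Finset V} (he : e ∈ G) :
    Fintype.card (Finset V → Fin Q) ≤
      Q * #{f : Finset V → Fin Q | e ⊆ selectedCover G f} := by
  refine (card_le_mul_card_apply_eq_zero Q e).trans (Nat.mul_le_mul_left _ (card_le_card ?_))
  intro f hf
  simp only [mem_filter, mem_univ, true_and] at hf ⊢
  exact subset_biUnion_of_mem id (mem_filter.2 ⟨he, hf⟩)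

open Finset in
/-- A non-edge is covered only if two distinct edges meeting it are selected. -/
lemma card_subset_selectedCover_mul_le {V : Type*} [DecidableEq V] [Fintype V] {Q r : ℕ}
    [NeZero Q] (G : Finset (Finset V)) (hr : 0 < r) (hG : ∀ e ∈ G, #e = r)
    {e : Finset V} (hcard : #e = r) (he : e ∉ G) :
    #{f : Finset V → Fin Q | e ⊆ selectedCover G f} * (Q * Q) ≤
      (r * maxDegree G) ^ 2 * Fintype.card (Finset V → Fin Q) := by
  let T : Finset (Finset V) := e.biUnion fun v => G.filter fun a => v ∈ a
  have hT : #T ≤ r * maxDegree G := by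
    rw [← hcard]
    exact card_biUnion_le_card_mul _ _ _ fun v _ =>
      le_sup (f := hyperDegree G) (mem_univ v)
  have hsub : ({f : Finset V → Fin Q | e ⊆ selectedCover G f} : Finset _) ⊆
      T.offDiag.biUnion fun p => {f : Finset V → Fin Q | f p.1 = 0 ∧ f p.2 = 0} := by
    intro f hf
    simp only [mem_filter, mem_univ, true_and] at hf
    obtain ⟨v, hv⟩ : e.Nonempty := card_pos.1 (hcard ▸ hr)
    obtain ⟨a, ha, hva⟩ := mem_biUnion.1 (hf hv)
    obtain ⟨haG, hfa⟩ := mem_filter.1 ha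
    have hea : ¬e ⊆ a := fun h =>
      he (eq_of_subset_of_card_le h (by rw [hG a haG, hcard]) ▸ haG)
    obtain ⟨u, hu, hua⟩ := not_subset.1 hea
    obtain ⟨b, hb, hub⟩ := mem_biUnion.1 (hf hu)
    obtain ⟨hbG, hfb⟩ := mem_filter.1 hb
    refine mem_biUnion.2 ⟨(a, b), mem_offDiag.2 ⟨?_, ?_, ?_⟩, by simp [hfa, hfb]⟩
    · exact mem_biUnion.2 ⟨v, hv, mem_filter.2 ⟨haG, hva⟩⟩
    · exact mem_biUnion.2 ⟨u, hu, mem_filter.2 ⟨hbG, hub⟩⟩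
    · exact fun hab => hua ((show a = b from hab) ▸ hub)
  calc #{f : Finset V → Fin Q | e ⊆ selectedCover G f} * (Q * Q)
      ≤ (∑ p ∈ T.offDiag, #{f : Finset V → Fin Q | f p.1 = 0 ∧ f p.2 = 0}) * (Q * Q) :=
        Nat.mul_le_mul_right _ ((card_le_card hsub).trans card_biUnion_le)
    _ ≤ ∑ p ∈ T.offDiag, Fintype.card (Finset V → Fin Q) := by
        rw [sum_mul]
        exact sum_le_sum fun p hp => card_apply_eq_zero_pair_mul_le Q (mem_offDiag.1 hp).2.2
    _ ≤ (r * maxDegree G) ^ 2 * Fintype.card (Finset V → Fin Q) := by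
        rw [sum_const, smul_eq_mul, offDiag_card]
        refine Nat.mul_le_mul_right _ ((Nat.sub_le _ _).trans ?_)
        rw [sq]
        exact Nat.mul_le_mul hT hT

open Finset in
/-- An `r`-uniform hypergraph is `k`-represented by `8 k r² Δ²` elements, for large `k`. -/
lemma kRepresents_of_card_mul_exp_lt_one {V : Type*} [DecidableEq V] [Fintype V] {r k : ℕ}
    (G : Finset (Finset V)) (hr : 0 < r) (hG : ∀ e ∈ G, #e = r) (hΔ : 0 < maxDegree G)
    (hk : ((Fintype.card V).choose r : ℝ) * Real.exp (-(k / 6)) < 1) :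
    KRepresents r k (2 * k * (4 * (r * maxDegree G) ^ 2)) G := by
  set Q := 4 * (r * maxDegree G) ^ 2 with hQdef
  have hQ : 0 < Q := by positivity
  have : NeZero Q := ⟨hQ.ne'⟩
  obtain ⟨ω, hω⟩ := exists_separating_sample (Ω := Finset V → Fin Q)
    (fun e f => e ⊆ selectedCover G f) (univ.powersetCard r) G k Q hQ
    (fun e _ he => card_le_mul_card_subset_selectedCover G he)
    (fun e hcard he => by
      have h := card_subset_selectedCover_mul_le (Q := Q) G hr hG (mem_powersetCard.1 hcard).2 he
      refine Nat.le_of_mul_le_mul_left ?_ hQ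
      calc Q * (4 * Q * #{f : Finset V → Fin Q | e ⊆ selectedCover G f})
          = 4 * (#{f : Finset V → Fin Q | e ⊆ selectedCover G f} * (Q * Q)) := by ring
        _ ≤ 4 * ((r * maxDegree G) ^ 2 * Fintype.card (Finset V → Fin Q)) :=
            Nat.mul_le_mul_left _ h
        _ = Q * Fintype.card (Finset V → Fin Q) := by rw [← mul_assoc, ← hQdef])
    (by rwa [card_powersetCard, card_univ])
  refine ⟨fun v => {j | v ∈ selectedCover G (ω j)}, fun e he => ?_⟩
  rw [hω e (mem_powersetCard.2 ⟨subset_univ _, he⟩)]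
  have hinf : (e.inf fun v => ({j | v ∈ selectedCover G (ω j)} : Finset (Fin (2 * k * Q)))) =
      ({j | e ⊆ selectedCover G (ω j)} : Finset (Fin (2 * k * Q))) := by
    ext j
    simp [Finset.mem_inf, subset_iff]
  rw [hinf]

/-- **Upper bound (general case).** For every `r ≥ 3` there exist a constant `C_r > 0` and
integers `Δ₀(r)`, `n₀(r)` such that every `r`-uniform hypergraph `G` on `n ≥ n₀` vertices
with maximum degree `Δ(G) = Δ ≥ Δ₀` satisfies `θ̃(G) ≤ C_r · Δ³ · log n`. -/
theorem thetaTilde_upper_bound_general :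
    ∀ r : ℕ, 3 ≤ r →
      ∃ (C : ℝ) (Δ₀ n₀ : ℕ), 0 < C ∧
        ∀ (n Δ : ℕ) (G : Finset (Finset (Fin n))),
          n₀ ≤ n → Δ₀ ≤ Δ →
          (∀ e ∈ G, e.card = r) →
          maxDegree G = Δ →
          (thetaTilde r G : ℝ) ≤ C * (Δ : ℝ) ^ 3 * Real.log n := by
  intro r hr
  refine ⟨8 * (r : ℝ) ^ 2 * (6 * r + 2), 1, 2, by positivity, ?_⟩
  intro n Δ G hn hΔ hG hmax
  have hn' : (2 : ℝ) ≤ n := by exact_mod_cast hn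
  have hlog : 1 / 2 ≤ Real.log n := by
    have := Real.log_le_log two_pos hn'
    linarith [Real.log_two_gt_d9]
  set k := ⌊6 * (r : ℝ) * Real.log n⌋₊ + 1 with hkdef
  have hklt : 6 * (r : ℝ) * Real.log n < k := by
    rw [hkdef]
    exact_mod_cast Nat.lt_floor_add_one _
  have hkle : (k : ℝ) ≤ (6 * r + 2) * Real.log n := by
    have := Nat.floor_le (show (0 : ℝ) ≤ 6 * r * Real.log n by positivity)
    rw [hkdef]
    push_cast
    linarith
  have hchoose : ((Fintype.card (Fin n)).choose r : ℝ) * Real.exp (-(k / 6)) < 1 := by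
    have hpow : (((Fintype.card (Fin n)).choose r : ℕ) : ℝ) ≤ Real.exp (r * Real.log n) := by
      rw [Real.exp_nat_mul, Real.exp_log (by linarith), Fintype.card_fin]
      exact_mod_cast Nat.choose_le_pow n r
    refine (mul_le_mul_of_nonneg_right hpow (Real.exp_pos _).le).trans_lt ?_
    rw [← Real.exp_add, Real.exp_lt_one_iff]
    linarith
  have hrep := kRepresents_of_card_mul_exp_lt_one G (by omega) hG (by omega) hchoose
  rw [hmax] at hrep
  have htheta : thetaTilde r G ≤ 2 * k * (4 * (r * Δ) ^ 2) :=
    Nat.sInf_le ⟨k, by omega, hrep⟩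
  have hΔ' : (1 : ℝ) ≤ Δ := by exact_mod_cast hΔ
  calc (thetaTilde r G : ℝ) ≤ 2 * k * (4 * (r * Δ) ^ 2) := by exact_mod_cast htheta
    _ = 8 * (r : ℝ) ^ 2 * Δ ^ 2 * k := by ring
    _ ≤ 8 * (r : ℝ) ^ 2 * Δ ^ 3 * ((6 * r + 2) * Real.log n) := by
        gcongr
        norm_num
    _ = 8 * (r : ℝ) ^ 2 * (6 * r + 2) * Δ ^ 3 * Real.log n := by ring
end

section
/- For every integer r ≥ 3 there exist a constant C_r > 0 and integers Δ₀ = Δ₀(r) and n₀ = n₀(r) such that: if G is a linear r-uniform hypergraph on n ≥ n₀ vertices with maximum degree Δ(G) = Δ ≥ Δ₀, then θ̃(G) ≤ C_r · Δ^{2 + 1/(r−1)} · log n. -/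
/-- A hypergraph is linear if any two distinct edges intersect in at most one vertex. -/
def IsLinear {V : Type*} [DecidableEq V] (G : Finset (Finset V)) : Prop :=
  ∀ e ∈ G, ∀ f ∈ G, e ≠ f → (e ∩ f).card ≤ 1

/-- Moment generating function of the number of hits in `t` independent uniform trials. -/
lemma sum_pow_card_hits {Ω : Type*} [Fintype Ω] (h : Ω → Prop) [DecidablePred h] (t : ℕ) (a : ℝ) :
    ∑ ω : Fin t → Ω, a ^ (Finset.univ.filter fun i => h (ω i)).card =
      (Fintype.card Ω + (a - 1) * (Finset.univ.filter h).card) ^ t := by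
  have h1 : (Fintype.card Ω + (a - 1) * (Finset.univ.filter h).card : ℝ) =
      ∑ x : Ω, if h x then a else 1 := by
    have h2 : ∀ x : Ω, (if h x then a else 1) = 1 + (a - 1) * (if h x then 1 else 0) := by
      intro x; split_ifs <;> ring
    simp_rw [h2, Finset.sum_add_distrib, ← Finset.mul_sum, Finset.sum_boole]
    simp
  rw [h1, Fintype.sum_pow]
  refine Finset.sum_congr rfl fun ω _ => ?_
  rw [Finset.prod_ite]
  simp

/-- Independent uniform trials separate a family `P` of events of probability at least `1 / M`
from a family `Q` of events of probability at most `1 / (8 M)`. -/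
lemma exists_separating_trials {Ω ι : Type*} [Fintype Ω] [Nonempty Ω] (hit : Ω → ι → Prop)
    [∀ x e, Decidable (hit x e)] (P Q : Finset ι) (M L : ℕ) (hM : 0 < M)
    (hP : ∀ e ∈ P, Fintype.card Ω ≤ M * (Finset.univ.filter fun x => hit x e).card)
    (hQ : ∀ e ∈ Q, 8 * M * (Finset.univ.filter fun x => hit x e).card ≤ Fintype.card Ω)
    (hL : ((P.card : ℝ) + Q.card) * (3 / 5) ^ L < 1) :
    ∃ ω : Fin (4 * M * L) → Ω,
      (∀ e ∈ P, 2 * L ≤ (Finset.univ.filter fun i => hit (ω i) e).card) ∧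
      ∀ e ∈ Q, (Finset.univ.filter fun i => hit (ω i) e).card < 2 * L := by
  by_contra! hcon
  obtain ⟨W, hW⟩ : ∃ W : ℝ, W = Fintype.card Ω := ⟨_, rfl⟩
  have hWpos : 0 < W := by rw [hW]; exact_mod_cast Fintype.card_pos
  have hMr : (0 : ℝ) < M := by exact_mod_cast hM
  let X : (Fin (4 * M * L) → Ω) → ι → ℕ := fun ω e =>
    (Finset.univ.filter fun i => hit (ω i) e).card
  have hone : ∀ ω : Fin (4 * M * L) → Ω,
      1 ≤ ∑ e ∈ P, (2 : ℝ) ^ (2 * L) * (1 / 2) ^ X ω e +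
        ∑ e ∈ Q, (1 / 2 : ℝ) ^ (2 * L) * 2 ^ X ω e := by
    intro ω
    have nP : 0 ≤ ∑ e ∈ P, (2 : ℝ) ^ (2 * L) * (1 / 2) ^ X ω e :=
      Finset.sum_nonneg fun _ _ => by positivity
    have nQ : 0 ≤ ∑ e ∈ Q, (1 / 2 : ℝ) ^ (2 * L) * 2 ^ X ω e :=
      Finset.sum_nonneg fun _ _ => by positivity
    by_cases hall : ∀ e ∈ P, 2 * L ≤ X ω e
    · obtain ⟨e, he, hX⟩ := hcon ω hall
      have h1 : (1 : ℝ) ≤ (1 / 2 : ℝ) ^ (2 * L) * 2 ^ X ω e := by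
        rw [one_div, inv_pow, inv_mul_eq_div, le_div_iff₀ (by positivity), one_mul]
        exact pow_le_pow_right₀ (by norm_num) hX
      have h2 := Finset.single_le_sum (f := fun e => (1 / 2 : ℝ) ^ (2 * L) * 2 ^ X ω e)
        (fun _ _ => by positivity) he
      linarith
    · push Not at hall
      obtain ⟨e, he, hX⟩ := hall
      have h1 : (1 : ℝ) ≤ (2 : ℝ) ^ (2 * L) * (1 / 2) ^ X ω e := by
        rw [one_div, inv_pow, ← div_eq_mul_inv, le_div_iff₀ (by positivity), one_mul]
        exact pow_le_pow_right₀ (by norm_num) hX.le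
      have h2 := Finset.single_le_sum (f := fun e => (2 : ℝ) ^ (2 * L) * (1 / 2) ^ X ω e)
        (fun _ _ => by positivity) he
      linarith
  have hsum := Finset.sum_le_sum fun ω (_ : ω ∈ Finset.univ) => hone ω
  rw [Finset.sum_add_distrib, Finset.sum_comm, Finset.sum_comm (t := Q)] at hsum
  simp only [← Finset.mul_sum] at hsum
  have hPe : ∀ e ∈ P, (2 : ℝ) ^ (2 * L) * ∑ ω, (1 / 2 : ℝ) ^ X ω e ≤
      W ^ (4 * M * L) * (3 / 5) ^ L := by
    intro e he
    have hc : W ≤ M * (Finset.univ.filter fun x => hit x e).card := by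
      rw [hW]; exact_mod_cast hP e he
    have hle : ((Finset.univ.filter fun x => hit x e).card : ℝ) ≤ W := by
      rw [hW]; exact_mod_cast Finset.card_le_univ _
    rw [sum_pow_card_hits (fun x => hit x e), ← hW]
    have hb : (W + (1 / 2 - 1) * (Finset.univ.filter fun x => hit x e).card : ℝ) ≤
        W * Real.exp (-(1 / (2 * M))) := by
      have h1 := Real.add_one_le_exp (-(1 / (2 * M : ℝ)))
      have h2 : W / M ≤ (Finset.univ.filter fun x => hit x e).card := by
        rw [div_le_iff₀ hMr]; linarith
      have h3 : W * (1 / (2 * M)) = W / M / 2 := by field_simp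
      nlinarith [mul_le_mul_of_nonneg_left h1 hWpos.le]
    have hexp : Real.exp (-(1 / (2 * M))) ^ (4 * M * L) = (Real.exp (-2)) ^ L := by
      rw [← Real.exp_nat_mul, ← Real.exp_nat_mul]
      congr 1; push_cast; field_simp; ring
    have h4 : 4 * Real.exp (-2) ≤ 3 / 5 := by
      have h5 : Real.exp 2 = Real.exp 1 * Real.exp 1 := by rw [← Real.exp_add]; norm_num
      rw [Real.exp_neg, ← div_eq_mul_inv, div_le_iff₀ (Real.exp_pos _), h5]
      nlinarith [Real.exp_one_gt_d9]
    calc _ ≤ (2 : ℝ) ^ (2 * L) * (W * Real.exp (-(1 / (2 * M)))) ^ (4 * M * L) := by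
          gcongr
          linarith
      _ = W ^ (4 * M * L) * (4 * Real.exp (-2)) ^ L := by
          rw [mul_pow, hexp, pow_mul 2 2 L, mul_pow 4]; norm_num; ring
      _ ≤ _ := by gcongr
  have hQe : ∀ e ∈ Q, (1 / 2 : ℝ) ^ (2 * L) * ∑ ω, (2 : ℝ) ^ X ω e ≤
      W ^ (4 * M * L) * (3 / 5) ^ L := by
    intro e he
    have hc : 8 * M * (Finset.univ.filter fun x => hit x e).card ≤ W := by
      rw [hW]; exact_mod_cast hQ e he
    rw [sum_pow_card_hits (fun x => hit x e), ← hW]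
    have hb : (W + (2 - 1) * (Finset.univ.filter fun x => hit x e).card : ℝ) ≤
        W * Real.exp (1 / (8 * M)) := by
      have h1 := Real.add_one_le_exp (1 / (8 * M : ℝ))
      have h2 : ((Finset.univ.filter fun x => hit x e).card : ℝ) ≤ W * (1 / (8 * M)) := by
        rw [mul_one_div, le_div_iff₀ (by positivity)]; linarith
      nlinarith [mul_le_mul_of_nonneg_left h1 hWpos.le]
    have hexp : Real.exp (1 / (8 * M)) ^ (4 * M * L) = (Real.exp (1 / 2)) ^ L := by
      rw [← Real.exp_nat_mul, ← Real.exp_nat_mul]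
      congr 1; push_cast; field_simp; ring
    have h4 : 1 / 4 * Real.exp (1 / 2) ≤ 3 / 5 := by
      have h5 : Real.exp 1 = Real.exp (1 / 2) * Real.exp (1 / 2) := by
        rw [← Real.exp_add]; norm_num
      nlinarith [Real.exp_one_lt_d9, Real.exp_pos (1 / 2)]
    calc _ ≤ (1 / 2 : ℝ) ^ (2 * L) * (W * Real.exp (1 / (8 * M))) ^ (4 * M * L) := by
          gcongr
      _ = W ^ (4 * M * L) * (1 / 4 * Real.exp (1 / 2)) ^ L := by
          rw [mul_pow, hexp, pow_mul (1 / 2) 2 L, mul_pow (1 / 4)]; norm_num; ring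
      _ ≤ _ := by gcongr
  have h1 := Finset.sum_le_sum hPe
  have h2 := Finset.sum_le_sum hQe
  simp only [Finset.sum_const, nsmul_eq_mul, Finset.card_univ, Fintype.card_fun,
    Fintype.card_fin, mul_one] at h1 h2 hsum
  push_cast at hsum
  rw [← hW] at hsum
  rw [← Finset.mul_sum] at h1 h2
  have hWt : 0 < W ^ (4 * M * L) := by positivity
  have h3 : W ^ (4 * M * L) ≤ W ^ (4 * M * L) * (((P.card : ℝ) + Q.card) * (3 / 5) ^ L) := by
    linarith
  nlinarith

/-- Number of colourings giving colour `c` to every element of `s`. -/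
lemma card_colourings_const_on {α β : Type*} [Fintype α] [DecidableEq α] [Fintype β]
    [DecidableEq β] (c : β) (s : Finset α) :
    Fintype.card β ^ s.card * (Finset.univ.filter fun x : α → β => ∀ a ∈ s, x a = c).card =
      Fintype.card (α → β) := by
  have h : (Finset.univ.filter fun x : α → β => ∀ a ∈ s, x a = c) =
      Fintype.piFinset fun a => if a ∈ s then {c} else Finset.univ := by
    ext x
    simp only [Finset.mem_filter, Finset.mem_univ, true_and, Fintype.mem_piFinset]
    refine forall_congr' fun a => ?_
    by_cases ha : a ∈ s <;> simp [ha]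
  rw [h, Fintype.card_piFinset, Fintype.card_fun, ← Finset.card_add_card_compl s, pow_add]
  congr 1
  simp only [apply_ite Finset.card, Finset.card_singleton, Finset.card_univ]
  rw [Finset.prod_ite]
  simp [Finset.filter_not, Finset.compl_eq_univ_sdiff]

/-- An `r`-uniform hypergraph of maximum degree at most `d` is represented by
`32 r² d² L` elements as soon as `L` is large compared to `log n`. -/
lemma kRepresents_of_maxDegree_le {V : Type*} [Fintype V] [DecidableEq V] (r d L : ℕ)
    (hr : 0 < r) (hd : 0 < d) (G : Finset (Finset V)) (hG : ∀ e ∈ G, e.card = r)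
    (hdeg : ∀ v, hyperDegree G v ≤ d)
    (hL : ((Fintype.card V : ℝ)) ^ r * (3 / 5) ^ L < 1) :
    KRepresents r (2 * L) (4 * (8 * (r * d) ^ 2) * L) G := by
  classical
  set M := 8 * (r * d) ^ 2 with hMdef
  have hM : 0 < M := by positivity
  have : NeZero M := ⟨hM.ne'⟩
  let cov : (Finset V → Fin M) → V → Prop := fun x v => ∃ f ∈ G, v ∈ f ∧ x f = 0
  have hP : ∀ e ∈ G, Fintype.card (Finset V → Fin M) ≤
      M * (Finset.univ.filter fun x : Finset V → Fin M => ∀ v ∈ e, cov x v).card := by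
    intro e he
    rw [← card_colourings_const_on (0 : Fin M) {e}]
    simp only [Fintype.card_fin, Finset.card_singleton, pow_one]
    gcongr with x
    intro hx v hv
    exact ⟨e, he, hv, hx e (by simp)⟩
  have hQ : ∀ e ∈ (Finset.univ.powersetCard r).filter (fun e : Finset V => e ∉ G),
      8 * M * (Finset.univ.filter fun x : Finset V → Fin M => ∀ v ∈ e, cov x v).card ≤
        Fintype.card (Finset V → Fin M) := by
    intro e he
    simp only [Finset.mem_filter, Finset.mem_powersetCard, Finset.subset_univ, true_and] at he
    obtain ⟨hcard, heG⟩ := he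
    let N : Finset (Finset V) := e.biUnion fun v => G.filter fun f => v ∈ f
    have hN : N.card ≤ r * d := by
      rw [← hcard]
      exact Finset.card_biUnion_le_card_mul _ _ _ fun v _ => hdeg v
    have hsub : (Finset.univ.filter fun x : Finset V → Fin M => ∀ v ∈ e, cov x v) ⊆
        N.offDiag.biUnion fun p =>
          Finset.univ.filter fun x : Finset V → Fin M => ∀ f ∈ ({p.1, p.2} : Finset _), x f = 0 := by
      intro x hx
      simp only [Finset.mem_filter, Finset.mem_univ, true_and] at hx
      obtain ⟨v, hv⟩ : e.Nonempty := Finset.card_pos.mp (by omega)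
      obtain ⟨f, hf, hvf, hxf⟩ := hx v hv
      have hnot : ¬ e ⊆ f := fun h => heG (by
        rwa [Finset.eq_of_subset_of_card_le h (by rw [hG f hf, hcard])])
      obtain ⟨w, hw, hwf⟩ := Finset.not_subset.mp hnot
      obtain ⟨g, hg, hwg, hxg⟩ := hx w hw
      simp only [Finset.mem_biUnion, Finset.mem_offDiag, Finset.mem_filter, Finset.mem_univ,
        true_and, N]
      refine ⟨(f, g), ⟨⟨v, hv, hf, hvf⟩, ⟨w, hw, hg, hwg⟩, ?_⟩, ?_⟩
      · intro hfg
        have hfg' : f = g := hfg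
        exact hwf (hfg' ▸ hwg)
      · simp [hxf, hxg]
    have hpair : ∀ p ∈ N.offDiag, M ^ 2 * (Finset.univ.filter fun x : Finset V → Fin M =>
        ∀ f ∈ ({p.1, p.2} : Finset _), x f = 0).card = Fintype.card (Finset V → Fin M) := by
      intro p hp
      have h := card_colourings_const_on (0 : Fin M) ({p.1, p.2} : Finset (Finset V))
      rwa [Finset.card_pair (Finset.mem_offDiag.mp hp).2.2, Fintype.card_fin] at h
    have hoff : N.offDiag.card ≤ (r * d) ^ 2 := by
      rw [Finset.offDiag_card]
      calc N.card * N.card - N.card ≤ N.card * N.card := Nat.sub_le _ _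
        _ ≤ (r * d) * (r * d) := Nat.mul_le_mul hN hN
        _ = _ := by ring
    have h1 : M ^ 2 * (Finset.univ.filter fun x : Finset V → Fin M => ∀ v ∈ e, cov x v).card ≤
        (r * d) ^ 2 * Fintype.card (Finset V → Fin M) := by
      calc _ ≤ M ^ 2 * ∑ p ∈ N.offDiag, (Finset.univ.filter fun x : Finset V → Fin M =>
            ∀ f ∈ ({p.1, p.2} : Finset _), x f = 0).card := by
            gcongr
            exact (Finset.card_le_card hsub).trans Finset.card_biUnion_le
        _ = N.offDiag.card * Fintype.card (Finset V → Fin M) := by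
            rw [Finset.mul_sum, Finset.sum_congr rfl hpair, Finset.sum_const, smul_eq_mul]
        _ ≤ _ := by gcongr
    refine Nat.le_of_mul_le_mul_left (c := (r * d) ^ 2) ?_ (by positivity)
    calc _ = M ^ 2 * (Finset.univ.filter fun x : Finset V → Fin M => ∀ v ∈ e, cov x v).card := by
          have hM2 : (r * d) ^ 2 * (8 * M) = M ^ 2 := by rw [hMdef]; ring
          rw [← mul_assoc, hM2]
      _ ≤ _ := h1
  have hcount : ((G.card : ℝ) +
      ((Finset.univ.powersetCard r).filter (fun e : Finset V => e ∉ G)).card) ≤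
      (Fintype.card V : ℝ) ^ r := by
    have h1 : G ⊆ Finset.univ.powersetCard r := fun e he => by
      simp [Finset.mem_powersetCard, hG e he]
    have h2 : G.card + ((Finset.univ.powersetCard r).filter (fun e : Finset V => e ∉ G)).card =
        (Fintype.card V).choose r := by
      rw [← Finset.card_univ, ← Finset.card_powersetCard, ← Finset.sdiff_eq_filter, add_comm,
        Finset.card_sdiff_add_card_eq_card h1]
    exact_mod_cast h2.le.trans (Nat.choose_le_pow _ _)
  obtain ⟨ω, hω1, hω2⟩ := exists_separating_trials
    (fun (x : Finset V → Fin M) (e : Finset V) => ∀ v ∈ e, cov x v) G _ M L hM hP hQ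
    (lt_of_le_of_lt (by gcongr) hL)
  refine ⟨fun v => Finset.univ.filter fun i => cov (ω i) v, fun e he => ?_⟩
  have hinf : (e.inf fun v => Finset.univ.filter fun i => cov (ω i) v) =
      Finset.univ.filter fun i => ∀ v ∈ e, cov (ω i) v := by
    ext i
    simp [Finset.mem_inf]
  rw [hinf]
  refine ⟨hω1 e, fun h => ?_⟩
  by_contra hne
  exact absurd h (not_le.mpr (hω2 e (by simp [Finset.mem_powersetCard, he, hne])))

/-- **Upper bound (linear case).** For every `r ≥ 3` there exist a constant `C_r > 0` and
integers `Δ₀(r)`, `n₀(r)` such that every linear `r`-uniform hypergraph `G` on `n ≥ n₀`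
vertices with maximum degree `Δ(G) = Δ ≥ Δ₀` satisfies
`θ̃(G) ≤ C_r · Δ^{2 + 1/(r-1)} · log n`. -/
theorem thetaTilde_upper_bound_linear :
    ∀ r : ℕ, 3 ≤ r →
      ∃ (C : ℝ) (Δ₀ n₀ : ℕ), 0 < C ∧
        ∀ (n Δ : ℕ) (G : Finset (Finset (Fin n))),
          n₀ ≤ n → Δ₀ ≤ Δ →
          (∀ e ∈ G, e.card = r) →
          IsLinear G →
          maxDegree G = Δ →
          (thetaTilde r G : ℝ) ≤
            C * (Δ : ℝ) ^ ((2 : ℝ) + 1 / ((r : ℝ) - 1)) * Real.log n := by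
  intro r hr
  refine ⟨32 * r ^ 2 * (4 * r + 2), 1, 2, by positivity, ?_⟩
  intro n Δ G hn hΔ hG _ hmax
  have hr1 : (3 : ℝ) ≤ r := by exact_mod_cast hr
  have hΔ1 : (1 : ℝ) ≤ Δ := by exact_mod_cast hΔ
  have hn2 : (2 : ℝ) ≤ n := by exact_mod_cast hn
  have hlog : 1 / 2 ≤ Real.log n :=
    (by linarith [Real.log_two_gt_d9] : 1 / 2 ≤ Real.log 2).trans
      (Real.log_le_log (by norm_num) hn2)
  set L := ⌈4 * r * Real.log n⌉₊ with hLdef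
  have hL1 : 4 * r * Real.log n ≤ L := Nat.le_ceil _
  have hL2 : (L : ℝ) < 4 * r * Real.log n + 1 := Nat.ceil_lt_add_one (by positivity)
  have hLpos : 0 < L := Nat.ceil_pos.mpr (by positivity)
  have hsmall : ((Fintype.card (Fin n) : ℝ)) ^ r * (3 / 5) ^ L < 1 := by
    rw [Fintype.card_fin]
    have h1 : (3 / 5 : ℝ) ^ L ≤ Real.exp (-(2 / 5) * L) := by
      rw [mul_comm, Real.exp_nat_mul]
      gcongr
      linarith [Real.add_one_le_exp (-(2 / 5 : ℝ))]
    have h2 : (n : ℝ) ^ r = Real.exp (r * Real.log n) := by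
      rw [Real.exp_nat_mul, Real.exp_log (by linarith)]
    calc _ ≤ Real.exp (r * Real.log n) * Real.exp (-(2 / 5) * L) := by rw [h2]; gcongr
      _ = Real.exp (r * Real.log n + -(2 / 5) * L) := (Real.exp_add _ _).symm
      _ < 1 := by
          rw [Real.exp_lt_one_iff]
          have : 0 < r * Real.log n := by positivity
          linarith
  have hrep := kRepresents_of_maxDegree_le r Δ L (by omega) (by omega) G hG
    (fun v => hmax ▸ Finset.le_sup (Finset.mem_univ v)) hsmall
  have hθ : thetaTilde r G ≤ 4 * (8 * (r * Δ) ^ 2) * L :=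
    Nat.sInf_le ⟨2 * L, by omega, hrep⟩
  have hpow : (Δ : ℝ) ^ 2 ≤ (Δ : ℝ) ^ ((2 : ℝ) + 1 / ((r : ℝ) - 1)) := by
    rw [← Real.rpow_natCast]
    refine Real.rpow_le_rpow_of_exponent_le hΔ1 ?_
    have : (0 : ℝ) ≤ 1 / ((r : ℝ) - 1) := one_div_nonneg.mpr (by linarith)
    push_cast
    linarith
  calc (thetaTilde r G : ℝ) ≤ ((4 * (8 * (r * Δ) ^ 2) * L : ℕ) : ℝ) := by exact_mod_cast hθ
    _ = 32 * r ^ 2 * Δ ^ 2 * L := by push_cast; ring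
    _ ≤ 32 * r ^ 2 * Δ ^ 2 * ((4 * r + 2) * Real.log n) := by
        gcongr
        linarith
    _ = 32 * r ^ 2 * (4 * r + 2) * Δ ^ 2 * Real.log n := by ring
    _ ≤ _ := by gcongr
end

section
/- Let r ≥ 2 be an integer, and let m, ε, p satisfy 2 ≤ m ≤ r, 0 < ε < 1 and 0 ≤ p ≤ 1. There exists an integer n₀ = n₀(r) such that if n and t are integers with n ≥ n₀ and t ≥ 3(m+1)·(log n)/(ε²·p^m), then there exist a set S of cardinality t and a family of subsets (R_i)_{i∈[n]} of S such that for every l with 1 ≤ l ≤ m and every l-element subset I ⊆ [n], the intersection ⋂_{j∈I} R_j has cardinality between (1−ε)·p^l·t and (1+ε)·p^l·t. -/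
/-- The probability of a subset of `ι`, given by its indicator `a`, when every element is chosen
independently with probability `p`. -/
def bernoulliWeight {ι : Type*} [Fintype ι] (p : ℝ) (a : ι → Bool) : ℝ :=
  ∏ i, if a i = true then p else 1 - p

lemma bernoulliWeight_nonneg {ι : Type*} [Fintype ι] {p : ℝ} (h0 : 0 ≤ p) (h1 : p ≤ 1)
    (a : ι → Bool) : 0 ≤ bernoulliWeight p a := by
  refine Finset.prod_nonneg fun i _ => ?_
  split_ifs <;> linarith

lemma sum_bernoulliWeight {ι : Type*} [Fintype ι] [DecidableEq ι] (p : ℝ) :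
    ∑ a : ι → Bool, bernoulliWeight p a = 1 := by
  unfold bernoulliWeight
  rw [← Fintype.prod_sum (fun (_ : ι) (b : Bool) => if b = true then p else 1 - p)]
  simp

lemma sum_bernoulliWeight_mul_indicator {ι : Type*} [Fintype ι] [DecidableEq ι] (p : ℝ)
    (I : Finset ι) :
    ∑ a : ι → Bool, bernoulliWeight p a * (if ∀ i ∈ I, a i = true then 1 else 0)
      = p ^ I.card := by
  have key : ∀ a : ι → Bool,
      bernoulliWeight p a * (if ∀ i ∈ I, a i = true then 1 else 0)
        = ∏ i, (if a i = true then p else if i ∈ I then 0 else 1 - p) := by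
    intro a
    unfold bernoulliWeight
    split_ifs with h
    · rw [mul_one]
      refine Finset.prod_congr rfl fun i _ => ?_
      by_cases hi : i ∈ I
      · simp [h i hi]
      · simp [hi]
    · push Not at h
      obtain ⟨i, hi, hai⟩ := h
      rw [mul_zero, eq_comm]
      exact Finset.prod_eq_zero (Finset.mem_univ i) (by simp [hi, hai])
  rw [Finset.sum_congr rfl fun a _ => key a,
    ← Fintype.prod_sum
      (fun (i : ι) (b : Bool) => if b = true then p else if i ∈ I then 0 else 1 - p)]
  have h2 : ∀ i : ι, (∑ b : Bool, if b = true then p else if i ∈ I then 0 else 1 - p)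
      = if i ∈ I then p else 1 := by
    intro i
    by_cases hi : i ∈ I <;> simp [hi]
  rw [Finset.prod_congr rfl fun i _ => h2 i]
  simp

/-- The moment generating function of the size of an intersection of independent random subsets
of `T`. -/
lemma sum_prod_bernoulliWeight_mul_pow {ι T : Type*} [Fintype ι] [DecidableEq ι] [Fintype T]
    [DecidableEq T] (p x : ℝ) (I : Finset ι) :
    ∑ ω : T → ι → Bool, (∏ s, bernoulliWeight p (ω s)) *
        x ^ (Finset.univ.filter fun s => ∀ i ∈ I, ω s i = true).card
      = (1 + p ^ I.card * (x - 1)) ^ Fintype.card T := by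
  have key : ∀ ω : T → ι → Bool, (∏ s, bernoulliWeight p (ω s)) *
        x ^ (Finset.univ.filter fun s => ∀ i ∈ I, ω s i = true).card
      = ∏ s, bernoulliWeight p (ω s) * (if ∀ i ∈ I, ω s i = true then x else 1) := by
    intro ω
    rw [Finset.prod_mul_distrib, Finset.prod_ite]
    simp
  have one : ∑ a : ι → Bool, bernoulliWeight p a * (if ∀ i ∈ I, a i = true then x else 1)
      = 1 + p ^ I.card * (x - 1) := by
    calc _ = ∑ a : ι → Bool, (bernoulliWeight p a +
          bernoulliWeight p a * (if ∀ i ∈ I, a i = true then 1 else 0) * (x - 1)) := by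
          refine Finset.sum_congr rfl fun a _ => ?_
          split_ifs <;> ring
      _ = _ := by
          rw [Finset.sum_add_distrib, ← Finset.sum_mul, sum_bernoulliWeight,
            sum_bernoulliWeight_mul_indicator]
  rw [Finset.sum_congr rfl fun ω _ => key ω,
    ← Fintype.prod_sum (fun (_ : T) (a : ι → Bool) =>
      bernoulliWeight p a * (if ∀ i ∈ I, a i = true then x else 1))]
  rw [one, Finset.prod_const, Finset.card_univ]

lemma sub_mul_log_one_add_le {ε : ℝ} (h0 : 0 < ε) (h1 : ε < 1) :
    ε - (1 + ε) * Real.log (1 + ε) ≤ -(ε ^ 2 / 3) := by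
  have h := mul_le_mul_of_nonneg_left (Real.le_log_one_add_of_nonneg h0.le)
    (by linarith : 0 ≤ 1 + ε)
  have h2 : ε + ε ^ 2 / 3 ≤ (1 + ε) * (2 * ε / (ε + 2)) := by
    rw [← mul_div_assoc, le_div_iff₀ (by linarith)]
    nlinarith [mul_pos h0 h0, mul_pos (mul_pos h0 h0) (sub_pos.2 h1)]
  linarith

lemma neg_sub_mul_log_one_sub_le {ε : ℝ} (h0 : 0 < ε) (h1 : ε < 1) :
    -ε - (1 - ε) * Real.log (1 - ε) ≤ -(ε ^ 2 / 3) := by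
  have hpos : 0 < 1 - ε := by linarith
  have h : Real.log (1 - ε)⁻¹ ≤ Real.sinh (Real.log (1 - ε)⁻¹) :=
    Real.self_le_sinh_iff.2 (Real.log_nonneg ((one_le_inv₀ hpos).2 (by linarith)))
  rw [Real.sinh_log (inv_pos.2 hpos), Real.log_inv, inv_inv] at h
  have h2 := mul_le_mul_of_nonneg_left h hpos.le
  have h3 : (1 - ε) * (((1 - ε)⁻¹ - (1 - ε)) / 2) = (1 - (1 - ε) ^ 2) / 2 := by
    field_simp
  nlinarith [sq_nonneg ε]

/-- The exponential Markov bound for the size of an intersection of independent random subsets,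
with the rate `D` left as a parameter. -/
lemma sum_prod_bernoulliWeight_mul_pow_mul_exp_le {ι T : Type*} [Fintype ι] [DecidableEq ι]
    [Fintype T] [DecidableEq T] {p x D : ℝ} (hp0 : 0 ≤ p) (hp1 : p ≤ 1) (hx : 0 < x)
    (hD : x - 1 - x * Real.log x ≤ -D) (I : Finset ι) :
    ∑ ω : T → ι → Bool, (∏ s, bernoulliWeight p (ω s)) *
        (x ^ (Finset.univ.filter fun s => ∀ i ∈ I, ω s i = true).card *
          Real.exp (-(x * p ^ I.card * Fintype.card T * Real.log x)))
      ≤ Real.exp (-(D * (p ^ I.card * Fintype.card T))) := by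
  simp only [← mul_assoc]
  rw [← Finset.sum_mul, sum_prod_bernoulliWeight_mul_pow]
  have hq0 : 0 ≤ p ^ I.card := pow_nonneg hp0 _
  have hq1 : p ^ I.card ≤ 1 := pow_le_one₀ hp0 hp1
  set q := p ^ I.card
  have hb : (1 + q * (x - 1)) ^ Fintype.card T ≤ Real.exp (Fintype.card T * (q * (x - 1))) := by
    rw [Real.exp_nat_mul]
    refine pow_le_pow_left₀ (by nlinarith) ?_ _
    linarith [Real.add_one_le_exp (q * (x - 1))]
  refine (mul_le_mul_of_nonneg_right hb (Real.exp_pos _).le).trans ?_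
  rw [← Real.exp_add, Real.exp_le_exp]
  have := mul_le_mul_of_nonneg_left hD (mul_nonneg hq0 (Nat.cast_nonneg (Fintype.card T)))
  linarith

lemma card_filter_nonempty_card_le {n m : ℕ} :
    (Finset.univ.filter fun I : Finset (Fin n) => I.Nonempty ∧ I.card ≤ m).card ≤ n ^ m := by
  calc _ ≤ ((Finset.univ : Finset (Fin m → Fin n)).image fun f => Finset.univ.image f).card := by
        refine Finset.card_le_card fun I hI => ?_
        obtain ⟨hne, hc⟩ := (Finset.mem_filter.1 hI).2
        obtain ⟨e⟩ := Function.Embedding.nonempty_of_card_le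
          (α := I) (β := Fin m) (by simpa using hc)
        have : Nonempty I := hne.to_subtype
        have hs := Function.invFun_surjective e.injective
        refine Finset.mem_image.2 ⟨fun k => (Function.invFun e k : I), Finset.mem_univ _, ?_⟩
        ext i
        simp only [Finset.mem_image, Finset.mem_univ, true_and]
        constructor
        · rintro ⟨k, rfl⟩
          exact (Function.invFun e k).2
        · intro hi
          obtain ⟨k, hk⟩ := hs ⟨i, hi⟩
          exact ⟨k, by rw [hk]⟩
    _ ≤ n ^ m := Finset.card_image_le.trans (by simp)

/-- **Random-subsets lemma (Chernoff bound).** Let `r ≥ 2`. There exists `n₀ = n₀(r)` such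
that for all `m, ε, p` with `2 ≤ m ≤ r`, `0 < ε < 1`, `0 ≤ p ≤ 1`, and all integers `n, t`
with `n ≥ n₀` and `t ≥ 3(m+1)·log n / (ε²·p^m)`, there exist a set `S` of cardinality `t`
(modeled as `Fin t`) and a family `(R_i)_{i ∈ [n]}` of subsets of `S` such that for every
`1 ≤ l ≤ m` and every `l`-element subset `I ⊆ [n]`,
`(1−ε)·p^l·t ≤ |⋂_{j∈I} R_j| ≤ (1+ε)·p^l·t`. -/
theorem random_subsets_intersections :
    ∀ r : ℕ, 2 ≤ r →
      ∃ n₀ : ℕ, ∀ (m : ℕ) (ε p : ℝ),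
        2 ≤ m → m ≤ r → 0 < ε → ε < 1 → 0 ≤ p → p ≤ 1 →
        ∀ n t : ℕ, n₀ ≤ n →
          3 * ((m : ℝ) + 1) * Real.log n / (ε ^ 2 * p ^ m) ≤ (t : ℝ) →
          ∃ R : Fin n → Finset (Fin t),
            ∀ l : ℕ, 1 ≤ l → l ≤ m →
              ∀ I : Finset (Fin n), I.card = l →
                (1 - ε) * p ^ l * t ≤ ((I.inf R).card : ℝ) ∧
                ((I.inf R).card : ℝ) ≤ (1 + ε) * p ^ l * t := by
  intro r _
  refine ⟨3, fun m ε p _ _ hε0 hε1 hp0 hp1 n t hn ht => ?_⟩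
  rcases hp0.eq_or_lt with rfl | hp
  · refine ⟨fun _ => ∅, fun l hl _ I hI => ?_⟩
    obtain ⟨i, hi⟩ : I.Nonempty := Finset.card_pos.1 (by omega)
    have : I.inf (fun _ => (∅ : Finset (Fin t))) = ∅ :=
      Finset.subset_empty.1 (Finset.inf_le (f := fun _ => (∅ : Finset (Fin t))) hi)
    simp [this, zero_pow (by omega : l ≠ 0)]
  have hn0 : (0 : ℝ) < n := by exact_mod_cast (by omega : 0 < n)
  have ht' : ((m : ℝ) + 1) * Real.log n ≤ ε ^ 2 / 3 * (p ^ m * t) := by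
    rw [div_le_iff₀ (by positivity)] at ht
    linarith
  let N (ω : Fin t → Fin n → Bool) (I : Finset (Fin n)) : ℕ :=
    (Finset.univ.filter fun s => ∀ i ∈ I, ω s i = true).card
  let tail (x : ℝ) (I : Finset (Fin n)) (ω : Fin t → Fin n → Bool) : ℝ :=
    x ^ N ω I * Real.exp (-(x * p ^ I.card * Fintype.card (Fin t) * Real.log x))
  let P (ω : Fin t → Fin n → Bool) : ℝ := ∏ s, bernoulliWeight p (ω s)
  let F := Finset.univ.filter fun I : Finset (Fin n) => I.Nonempty ∧ I.card ≤ m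
  have tail_bound : ∀ x : ℝ, 0 < x → x - 1 - x * Real.log x ≤ -(ε ^ 2 / 3) → ∀ I ∈ F,
      ∑ ω, P ω * tail x I ω ≤ ((n : ℝ) ^ (m + 1))⁻¹ := by
    intro x hx hD I hI
    have hchernoff :=
      sum_prod_bernoulliWeight_mul_pow_mul_exp_le (T := Fin t) hp0 hp1 hx hD I
    refine (le_of_eq_of_le ?_ hchernoff).trans ?_
    · simp only [P, tail, N]
      congr!
    have hpow : p ^ m ≤ p ^ I.card :=
      pow_le_pow_of_le_one hp0 hp1 (Finset.mem_filter.1 hI).2.2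
    have hexp : ((n : ℝ) ^ (m + 1))⁻¹ = Real.exp (-(((m : ℝ) + 1) * Real.log n)) := by
      rw [Real.exp_neg, ← Nat.cast_succ, Real.exp_nat_mul, Real.exp_log hn0]
    rw [hexp, Real.exp_le_exp, neg_le_neg_iff, Fintype.card_fin]
    exact ht'.trans (by gcongr)
  have tail_nonneg : ∀ x : ℝ, 0 < x → ∀ I ω, 0 ≤ tail x I ω := fun x hx I ω => by
    positivity
  have hP : ∑ ω, P ω = 1 := by
    simpa [P] using sum_prod_bernoulliWeight_mul_pow (ι := Fin n) (T := Fin t) p 1 ∅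
  have total : ∑ ω, P ω * ∑ I ∈ F, (tail (1 + ε) I ω + tail (1 - ε) I ω) < ∑ ω, P ω := by
    have hF : (F.card : ℝ) ≤ (n : ℝ) ^ m := by
      exact_mod_cast (card_filter_nonempty_card_le : F.card ≤ n ^ m)
    calc _ = ∑ I ∈ F, (∑ ω, P ω * tail (1 + ε) I ω + ∑ ω, P ω * tail (1 - ε) I ω) := by
          simp only [Finset.mul_sum]
          rw [Finset.sum_comm]
          simp only [mul_add, Finset.sum_add_distrib]
      _ ≤ ∑ I ∈ F, (((n : ℝ) ^ (m + 1))⁻¹ + ((n : ℝ) ^ (m + 1))⁻¹) := by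
          refine Finset.sum_le_sum fun I hI => add_le_add ?_ ?_
          · refine tail_bound _ (by linarith) ?_ I hI
            linarith [sub_mul_log_one_add_le hε0 hε1]
          · refine tail_bound _ (by linarith) ?_ I hI
            linarith [neg_sub_mul_log_one_sub_le hε0 hε1]
      _ = F.card * (2 * ((n : ℝ) ^ (m + 1))⁻¹) := by
          rw [Finset.sum_const, nsmul_eq_mul, two_mul]
      _ ≤ (n : ℝ) ^ m * (2 * ((n : ℝ) ^ (m + 1))⁻¹) := by gcongr
      _ = 2 / n := by
          rw [pow_succ]
          field_simp
      _ < 1 := by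
          rw [div_lt_one hn0]
          exact_mod_cast (by omega : 2 < n)
      _ = _ := hP.symm
  obtain ⟨ω, -, hω⟩ := Finset.exists_lt_of_sum_lt total
  have hPω : 0 ≤ P ω := Finset.prod_nonneg fun s _ => bernoulliWeight_nonneg hp0 hp1 _
  have hlt : ∑ I ∈ F, (tail (1 + ε) I ω + tail (1 - ε) I ω) < 1 := by
    by_contra! h
    exact absurd hω (not_lt.2 (le_mul_of_one_le_right hPω h))
  refine ⟨fun i => Finset.univ.filter fun s => ω s i = true, fun l hl hlm I hI => ?_⟩
  have hIF : I ∈ F := by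
    simp only [F, Finset.mem_filter, Finset.mem_univ, true_and]
    exact ⟨Finset.card_pos.1 (by omega), by omega⟩
  have hcard : (I.inf fun i => Finset.univ.filter fun s => ω s i = true).card = N ω I := by
    refine congrArg Finset.card ?_
    ext s
    simp [Finset.mem_inf]
  have hterm := (Finset.single_le_sum (f := fun I => tail (1 + ε) I ω + tail (1 - ε) I ω)
    (fun J _ => add_nonneg (tail_nonneg (1 + ε) (by linarith) J ω)
      (tail_nonneg (1 - ε) (by linarith) J ω)) hIF).trans_lt hlt
  have tail_lt : ∀ x : ℝ, 0 < x → tail x I ω < 1 →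
      ((N ω I : ℝ) - x * p ^ l * t) * Real.log x < 0 := by
    intro x hx h
    simp only [tail] at h
    rw [← Real.exp_log (pow_pos hx _), ← Real.exp_add, Real.exp_lt_one_iff, Real.log_pow, hI,
      Fintype.card_fin] at h
    linarith
  have hup := tail_lt (1 + ε) (by linarith)
    (by linarith [tail_nonneg (1 - ε) (by linarith) I ω])
  have hlo := tail_lt (1 - ε) (by linarith)
    (by linarith [tail_nonneg (1 + ε) (by linarith) I ω])
  have hlogup : 0 < Real.log (1 + ε) := Real.log_pos (by linarith)
  have hloglo : Real.log (1 - ε) < 0 := Real.log_neg (by linarith) (by linarith)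
  rw [hcard]
  constructor
  · by_contra! h
    nlinarith
  · by_contra! h
    nlinarith
end

section
/- There exists a constant A > 0 such that for every integer r ≥ 3 there are positive integers n₀ = n₀(r) and L₀ = L₀(r) with the following property: for every n ≥ n₀ and L ≥ L₀, if G is an r-uniform hypergraph on n vertices whose chromatic index satisfies χ'(G) ≤ L, then θ̃(G) ≤ A · L³ · log n. -/
/-- The chromatic index `χ'(G)`: the smallest `L` such that `E(G)` can be partitioned
into `L` matchings. -/
noncomputable def chromIndex {V : Type*} [DecidableEq V] (G : Finset (Finset V)) : ℕ :=
  sInf {L : ℕ | ∃ c : Finset V → ℕ, (∀ e ∈ G, c e < L) ∧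
    ∀ e ∈ G, ∀ f ∈ G, e ≠ f → c e = c f → Disjoint e f}

open Finset in
/-- If `f` has mean at most `1 + d` over `Ω`, then the product
of `f` over `t` independent samples has mean at most `exp (d * t)`. -/
lemma sum_prod_le_exp {Ω : Type*} [Fintype Ω] (f : Ω → ℝ) (hf : ∀ w, 0 ≤ f w)
    (d : ℝ) (h : ∑ w, f w ≤ (1 + d) * Fintype.card Ω) (t : ℕ) :
    ∑ w : Fin t → Ω, ∏ i, f (w i) ≤ Real.exp (d * t) * (Fintype.card Ω : ℝ) ^ t := by
  have h1 : ∑ w : Fin t → Ω, ∏ i, f (w i) = (∑ w, f w) ^ t := by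
    rw [Fintype.sum_pow]
  rw [h1, mul_comm d, Real.exp_nat_mul, ← mul_pow]
  refine pow_le_pow_left₀ (Finset.sum_nonneg fun w _ => hf w) (h.trans ?_) t
  gcongr
  linarith [Real.add_one_le_exp d]

open Finset in
/-- The moment generating function bound for the number of successes in `t` samples. -/
lemma sum_pow_card_le_exp {Ω : Type*} [Fintype Ω] (p : Ω → Prop) [DecidablePred p] (x : ℝ)
    (hx : 0 ≤ x) (d : ℝ)
    (h : (x - 1) * (univ.filter p).card ≤ d * Fintype.card Ω) (t : ℕ) :
    ∑ w : Fin t → Ω, x ^ (univ.filter fun i => p (w i)).card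
      ≤ Real.exp (d * t) * (Fintype.card Ω : ℝ) ^ t := by
  have h1 : ∀ w : Fin t → Ω, x ^ (univ.filter fun i => p (w i)).card
      = ∏ i, if p (w i) then x else 1 := by
    intro w
    rw [Finset.prod_ite]
    simp
  simp_rw [h1]
  refine sum_prod_le_exp (fun w => if p w then x else 1)
    (fun w => by split_ifs <;> linarith) d ?_ t
  have h2 : ∑ w, (if p w then x else (1 : ℝ))
      = (x - 1) * (univ.filter p).card + Fintype.card Ω := by
    have : ∀ w, (if p w then x else (1 : ℝ)) = (x - 1) * (if p w then 1 else 0) + 1 := by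
      intro w; split_ifs <;> ring
    simp_rw [this, sum_add_distrib, ← mul_sum]
    simp
  rw [h2]
  linarith

open Finset in
/-- Sampling separates the frequent properties (probability at least `1 / (4 L²)`) from the rare
ones (probability at most `1 / (16 L²)`). -/
lemma exists_separating_sample_s5 {Ω α : Type*} [Fintype Ω] [Nonempty Ω] (P : α → Ω → Prop)
    [∀ a, DecidablePred (P a)] (A B : Finset α) (L s : ℕ) (hL : 0 < L)
    (hA : ∀ a ∈ A, Fintype.card Ω ≤ (univ.filter (P a)).card * (4 * L ^ 2))
    (hB : ∀ a ∈ B, (univ.filter (P a)).card * (16 * L ^ 2) ≤ Fintype.card Ω)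
    (hs : ((A.card + B.card : ℕ) : ℝ) < Real.exp (s / 3)) :
    ∃ w : Fin (16 * L ^ 2 * s) → Ω,
      (∀ a ∈ A, 2 * s ≤ (univ.filter fun i => P a (w i)).card) ∧
      ∀ a ∈ B, (univ.filter fun i => P a (w i)).card < 2 * s := by
  classical
  by_contra! hcon
  set t := 16 * L ^ 2 * s with ht
  set N := fun (a : α) (w : Fin t → Ω) => (univ.filter fun i => P a (w i)).card with hN
  have hL' : (0 : ℝ) < L := by exact_mod_cast hL
  have htR : (t : ℝ) = 16 * L ^ 2 * s := by rw [ht]; push_cast; ring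
  have hexp : ∀ n : ℕ, Real.exp (n * Real.log 2) = 2 ^ n := fun n => by
    rw [Real.exp_nat_mul, Real.exp_log two_pos]
  have hlog := Real.log_two_gt_d9
  have hlog' := Real.log_two_lt_d9
  have hs0 : (0 : ℝ) ≤ s := Nat.cast_nonneg s
  have hcard : (0 : ℝ) < (Fintype.card Ω : ℝ) ^ t := by
    have : 0 < Fintype.card Ω := Fintype.card_pos
    positivity
  have cA : ∀ a ∈ A, ∑ w : Fin t → Ω, (2 : ℝ) ^ (2 * s) * (1 / 2) ^ N a w
      ≤ Real.exp (-(s / 3)) * (Fintype.card Ω : ℝ) ^ t := by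
    intro a ha
    rw [← mul_sum]
    have h0 : (Fintype.card Ω : ℝ) ≤ (univ.filter (P a)).card * (4 * L ^ 2) := by
      exact_mod_cast hA a ha
    have h1 := sum_pow_card_le_exp (P a) (1 / 2) (by norm_num) (-(1 / (8 * (L : ℝ) ^ 2))) (by
      rw [neg_mul, one_div_mul_eq_div, le_neg, div_le_iff₀ (by positivity)]
      linarith) t
    refine (mul_le_mul_of_nonneg_left h1 (by positivity)).trans ?_
    rw [← mul_assoc, ← hexp, ← Real.exp_add]
    gcongr
    have : -(1 / (8 * (L : ℝ) ^ 2)) * t = -(2 * s) := by rw [htR]; field_simp; ring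
    rw [this]
    push_cast
    nlinarith
  have cB : ∀ a ∈ B, ∑ w : Fin t → Ω, ((2 : ℝ) ^ (2 * s))⁻¹ * 2 ^ N a w
      ≤ Real.exp (-(s / 3)) * (Fintype.card Ω : ℝ) ^ t := by
    intro a ha
    rw [← mul_sum]
    have h0 : ((univ.filter (P a)).card : ℝ) * (16 * L ^ 2) ≤ Fintype.card Ω := by
      exact_mod_cast hB a ha
    have h1 := sum_pow_card_le_exp (P a) 2 (by norm_num) (1 / (16 * (L : ℝ) ^ 2)) (by
      rw [one_div_mul_eq_div, le_div_iff₀ (by positivity)]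
      linarith) t
    refine (mul_le_mul_of_nonneg_left h1 (by positivity)).trans ?_
    rw [← mul_assoc, ← hexp, ← Real.exp_neg, ← Real.exp_add]
    gcongr
    have : 1 / (16 * (L : ℝ) ^ 2) * t = s := by rw [htR]; field_simp
    rw [this]
    push_cast
    nlinarith
  have lower : ∀ w : Fin t → Ω, (1 : ℝ) ≤ ∑ a ∈ A, (2 : ℝ) ^ (2 * s) * (1 / 2) ^ N a w
      + ∑ a ∈ B, ((2 : ℝ) ^ (2 * s))⁻¹ * 2 ^ N a w := by
    intro w
    have pA : 0 ≤ ∑ a ∈ A, (2 : ℝ) ^ (2 * s) * (1 / 2) ^ N a w :=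
      sum_nonneg fun a _ => by positivity
    have pB : 0 ≤ ∑ a ∈ B, ((2 : ℝ) ^ (2 * s))⁻¹ * 2 ^ N a w :=
      sum_nonneg fun a _ => by positivity
    by_cases hw : ∀ a ∈ A, 2 * s ≤ N a w
    · obtain ⟨a, ha, hle⟩ := hcon w hw
      have h1 : (1 : ℝ) ≤ ((2 : ℝ) ^ (2 * s))⁻¹ * 2 ^ N a w := by
        rw [inv_mul_eq_div, one_le_div (by positivity)]
        exact pow_le_pow_right₀ one_le_two hle
      have h2 := single_le_sum (f := fun a => ((2 : ℝ) ^ (2 * s))⁻¹ * 2 ^ N a w)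
        (fun a _ => by positivity) ha
      linarith
    · push Not at hw
      obtain ⟨a, ha, hlt⟩ := hw
      have h1 : (1 : ℝ) ≤ (2 : ℝ) ^ (2 * s) * (1 / 2) ^ N a w := by
        rw [one_div, inv_pow, ← div_eq_mul_inv, one_le_div (by positivity)]
        exact pow_le_pow_right₀ one_le_two hlt.le
      have h2 := single_le_sum (f := fun a => (2 : ℝ) ^ (2 * s) * (1 / 2) ^ N a w)
        (fun a _ => by positivity) ha
      linarith
  have total := sum_le_sum fun w (_ : w ∈ (univ : Finset (Fin t → Ω))) => lower w
  rw [sum_add_distrib, sum_comm (s := univ) (t := A), sum_comm (s := univ) (t := B)] at total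
  have t1 := sum_le_sum cA
  have t2 := sum_le_sum cB
  simp only [sum_const, card_univ, Fintype.card_pi_const, nsmul_eq_mul, mul_one,
    Nat.cast_pow] at total t1 t2
  have key : ((A.card + B.card : ℕ) : ℝ) * Real.exp (-(s / 3)) < 1 := by
    rw [Real.exp_neg, ← div_eq_mul_inv, div_lt_one (Real.exp_pos _)]
    exact hs
  push_cast at key
  nlinarith

open Finset in
/-- The proportion of functions into `Fin m` vanishing on `B` is `m ^ (-#B)`. -/
lemma card_filter_eq_zero_mul_pow {β : Type*} [Fintype β] [DecidableEq β] (m : ℕ) [NeZero m]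
    (B : Finset β) :
    (univ.filter fun X : β → Fin m => ∀ b ∈ B, X b = 0).card * m ^ B.card
      = m ^ Fintype.card β := by
  have h : (univ.filter fun X : β → Fin m => ∀ b ∈ B, X b = 0)
      = Fintype.piFinset fun b => if b ∈ B then {0} else univ := by
    ext X
    simp only [mem_filter, mem_univ, true_and, Fintype.mem_piFinset]
    refine forall_congr' fun b => ?_
    split_ifs with hb <;> simp [hb]
  rw [h, Fintype.card_piFinset]
  have h2 : ∀ b, (if b ∈ B then ({0} : Finset (Fin m)) else univ).card
      = if b ∈ B then 1 else m := fun b => by split_ifs <;> simp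
  simp_rw [h2]
  rw [prod_ite, prod_const_one, one_mul, prod_const, ← pow_add]
  congr 1
  have := card_filter_add_card_filter_not (s := (univ : Finset β)) (fun b => b ∈ B)
  rw [card_univ] at this
  simp only [filter_mem_eq_inter, univ_inter] at this
  omega

/-- The block of `v` in the `i`-th colour class: the edge of colour `i` through `v` if there is one,
and the singleton `{v}` otherwise. -/
noncomputable def colorBlock {V : Type*} [DecidableEq V] (G : Finset (Finset V))
    (c : Finset V → ℕ) (i : ℕ) (v : V) : Finset V :=
  open Classical in if h : ∃ f ∈ G, c f = i ∧ v ∈ f then h.choose else {v}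

section colorBlock

variable {V : Type*} [DecidableEq V] {G : Finset (Finset V)} {c : Finset V → ℕ}

lemma mem_colorBlock (i : ℕ) (v : V) : v ∈ colorBlock G c i v := by
  unfold colorBlock
  split_ifs with h
  · exact h.choose_spec.2.2
  · simp

lemma colorBlock_mem_or (i : ℕ) (v : V) : colorBlock G c i v ∈ G ∨ colorBlock G c i v = {v} := by
  unfold colorBlock
  split_ifs with h
  · exact Or.inl h.choose_spec.1
  · exact Or.inr rfl

lemma colorBlock_eq_of_mem
    (hc : ∀ e ∈ G, ∀ f ∈ G, e ≠ f → c e = c f → Disjoint e f)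
    {e : Finset V} (he : e ∈ G) {v : V} (hv : v ∈ e) : colorBlock G c (c e) v = e := by
  have h : ∃ f ∈ G, c f = c e ∧ v ∈ f := ⟨e, he, rfl, hv⟩
  unfold colorBlock
  rw [dif_pos h]
  obtain ⟨h1, h2, h3⟩ := h.choose_spec
  by_contra hne
  exact Finset.disjoint_left.1 (hc _ h1 _ he hne h2) h3 hv

lemma card_image_colorBlock_of_mem
    (hc : ∀ e ∈ G, ∀ f ∈ G, e ≠ f → c e = c f → Disjoint e f)
    {e : Finset V} (he : e ∈ G) : (e.image (colorBlock G c (c e))).card ≤ 1 := by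
  refine (Finset.card_le_card (t := {e}) fun f hf => ?_).trans (by simp)
  obtain ⟨v, hv, rfl⟩ := Finset.mem_image.1 hf
  rw [colorBlock_eq_of_mem hc he hv]
  simp

lemma two_le_card_image_colorBlock {r : ℕ} (hr : 2 ≤ r) (hG : ∀ e ∈ G, e.card = r)
    {e : Finset V} (her : e.card = r) (he : e ∉ G) (i : ℕ) :
    2 ≤ (e.image (colorBlock G c i)).card := by
  by_contra! hlt
  obtain ⟨v, hv⟩ : e.Nonempty := Finset.card_pos.1 (by omega)
  have hsub : e ⊆ colorBlock G c i v := by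
    intro u hu
    have : colorBlock G c i u = colorBlock G c i v :=
      Finset.card_le_one.1 (Nat.lt_succ_iff.1 hlt) _ (Finset.mem_image_of_mem _ hu) _
        (Finset.mem_image_of_mem _ hv)
    rw [← this]
    exact mem_colorBlock i u
  rcases colorBlock_mem_or (G := G) (c := c) i v with h | h
  · have := Finset.eq_of_subset_of_card_le hsub (by rw [hG _ h, her])
    exact he (this ▸ h)
  · have := Finset.card_le_card hsub
    rw [h, Finset.card_singleton] at this
    omega

end colorBlock

open Finset in
/-- A properly edge-coloured `r`-uniform hypergraph with `L` colours is `2s`-represented by a set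
of size `16 L² s` as soon as `exp (s / 3)` exceeds the number of `r`-sets. -/
lemma kRepresents_of_coloring {V : Type*} [Fintype V] [DecidableEq V] {r L s : ℕ} (hr : 2 ≤ r)
    (hL : 0 < L) {G : Finset (Finset V)} (hG : ∀ e ∈ G, e.card = r) {c : Finset V → ℕ}
    (hcL : ∀ e ∈ G, c e < L) (hc : ∀ e ∈ G, ∀ f ∈ G, e ≠ f → c e = c f → Disjoint e f)
    (hs : (((Fintype.card V).choose r : ℕ) : ℝ) < Real.exp (s / 3)) :
    KRepresents r (2 * s) (16 * L ^ 2 * s) G := by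
  classical
  have : NeZero L := ⟨hL.ne'⟩
  have : NeZero (4 * L) := ⟨by omega⟩
  let Ω := Fin L × (Finset V → Fin (4 * L))
  let Z : Fin L → Finset V → Finset (Finset V → Fin (4 * L)) := fun i e =>
    univ.filter fun X => ∀ b ∈ e.image (colorBlock G c i), X b = 0
  let P : Finset V → Ω → Prop := fun e w => w.2 ∈ Z w.1 e
  have hsub : G ⊆ powersetCard r univ := fun e he => by simp [hG e he]
  have hΩ : Fintype.card Ω = L * (4 * L) ^ Fintype.card (Finset V) := by
    simp [Ω]
  have hP : ∀ e, (univ.filter (P e)).card = ∑ i, (Z i e).card := by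
    intro e
    rw [← card_sigma]
    refine card_bij' (fun w _ => ⟨w.1, w.2⟩) (fun w _ => (w.1, w.2)) ?_ ?_ ?_ ?_ <;> simp [P]
  have hZ : ∀ i e, (Z i e).card * (4 * L) ^ (e.image (colorBlock G c i)).card
      = (4 * L) ^ Fintype.card (Finset V) :=
    fun i e => card_filter_eq_zero_mul_pow (4 * L) _
  obtain ⟨w, hwA, hwB⟩ := exists_separating_sample_s5 P G (powersetCard r univ \ G) L s hL
    (by
      intro e he
      have h1 : (Z ⟨c e, hcL e he⟩ e).card ≤ (univ.filter (P e)).card := by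
        rw [hP]
        exact single_le_sum (f := fun i => (Z i e).card) (fun _ _ => Nat.zero_le _) (mem_univ _)
      have h2 := pow_le_pow_right₀ (show 1 ≤ 4 * L by omega) (card_image_colorBlock_of_mem hc he)
      rw [pow_one] at h2
      rw [hΩ, ← hZ ⟨c e, hcL e he⟩ e]
      calc _ ≤ L * ((univ.filter (P e)).card * (4 * L)) := by gcongr
        _ = _ := by ring)
    (by
      intro e he
      rw [mem_sdiff, mem_powersetCard] at he
      rw [hP, hΩ, sum_mul]
      have h1 : ∀ i ∈ (univ : Finset (Fin L)),
          (Z i e).card * (16 * L ^ 2) ≤ (4 * L) ^ Fintype.card (Finset V) := by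
        intro i _
        rw [← hZ i e]
        have h2 := pow_le_pow_right₀ (show 1 ≤ 4 * L by omega)
          (two_le_card_image_colorBlock (c := c) hr hG he.1.2 he.2 i)
        calc _ = (Z i e).card * (4 * L) ^ 2 := by ring
          _ ≤ _ := by gcongr
      simpa using sum_le_card_nsmul _ _ _ h1)
    (by
      rwa [card_sdiff_of_subset hsub, Nat.add_sub_cancel' (card_le_card hsub), card_powersetCard,
        card_univ])
  refine ⟨fun v => univ.filter fun j => (w j).2 (colorBlock G c (w j).1 v) = 0, fun e her => ?_⟩
  have hinf : (e.inf fun v => univ.filter fun j => (w j).2 (colorBlock G c (w j).1 v) = 0)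
      = univ.filter fun j => P e (w j) := by
    ext j
    simp [P, Z, Finset.mem_inf]
  rw [hinf]
  refine ⟨hwA e, fun h => ?_⟩
  by_contra he
  exact (hwB e (by simp [her, he])).not_ge h

/-- A hypergraph with chromatic index at most `L` has a proper edge colouring with `L` colours. -/
lemma exists_coloring_of_chromIndex_le {V : Type*} [DecidableEq V] {G : Finset (Finset V)} {L : ℕ}
    (h : chromIndex G ≤ L) : ∃ c : Finset V → ℕ, (∀ e ∈ G, c e < L) ∧
      ∀ e ∈ G, ∀ f ∈ G, e ≠ f → c e = c f → Disjoint e f := by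
  classical
  have hne : {L : ℕ | ∃ c : Finset V → ℕ, (∀ e ∈ G, c e < L) ∧
      ∀ e ∈ G, ∀ f ∈ G, e ≠ f → c e = c f → Disjoint e f}.Nonempty := by
    refine ⟨G.card, fun e => if h : e ∈ G then (G.equivFin ⟨e, h⟩ : ℕ) else 0, ?_, ?_⟩
    · intro e he
      simp [he]
    · intro e he f hf hef hcol
      simp only [he, hf, dif_pos] at hcol
      have := G.equivFin.injective (Fin.ext hcol)
      exact absurd (congrArg Subtype.val this) hef
  obtain ⟨c, h1, h2⟩ := Nat.sInf_mem hne
  exact ⟨c, fun e he => (h1 e he).trans_le h, h2⟩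

/-- **Main lemma (general case).** There is a constant `A > 0` such that for every `r ≥ 3`
there are positive integers `n₀(r)`, `L₀(r)` such that for all `n ≥ n₀` and `L ≥ L₀`,
every `r`-uniform hypergraph `G` on `n` vertices with `χ'(G) ≤ L` satisfies
`θ̃(G) ≤ A · L³ · log n`. -/
theorem thetaTilde_le_of_chromIndex_le :
    ∃ A : ℝ, 0 < A ∧
      ∀ r : ℕ, 3 ≤ r →
        ∃ n₀ L₀ : ℕ, 0 < n₀ ∧ 0 < L₀ ∧
          ∀ (n L : ℕ) (G : Finset (Finset (Fin n))),
            n₀ ≤ n → L₀ ≤ L →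
            (∀ e ∈ G, e.card = r) →
            chromIndex G ≤ L →
            (thetaTilde r G : ℝ) ≤ A * (L : ℝ) ^ 3 * Real.log n := by
  refine ⟨64, by norm_num, fun r hr => ⟨3, r, by norm_num, by omega, ?_⟩⟩
  intro n L G hn hL hG hχ
  obtain ⟨c, hcL, hc⟩ := exists_coloring_of_chromIndex_le hχ
  have hnR : (3 : ℝ) ≤ n := by exact_mod_cast hn
  have hlog : 1 ≤ Real.log n := by
    rw [Real.le_log_iff_exp_le (by linarith)]
    linarith [Real.exp_one_lt_d9]
  have hrR : (3 : ℝ) ≤ r := by exact_mod_cast hr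
  have hLR : (r : ℝ) ≤ L := by exact_mod_cast hL
  set s := ⌊3 * r * Real.log n⌋₊ + 1 with hs
  have hs1 : 3 * r * Real.log n < s := by
    rw [hs]; push_cast; exact Nat.lt_floor_add_one _
  have hs2 : (s : ℝ) ≤ 4 * r * Real.log n := by
    have := Nat.floor_le (show 0 ≤ 3 * r * Real.log n by positivity)
    rw [hs]; push_cast
    nlinarith
  have hcount : (((Fintype.card (Fin n)).choose r : ℕ) : ℝ) < Real.exp (s / 3) := by
    rw [Fintype.card_fin]
    calc ((n.choose r : ℕ) : ℝ) ≤ (n : ℝ) ^ r := by exact_mod_cast Nat.choose_le_pow n r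
      _ = Real.exp (r * Real.log n) := by rw [Real.exp_nat_mul, Real.exp_log (by linarith)]
      _ < _ := by rw [Real.exp_lt_exp]; linarith
  have hrep := kRepresents_of_coloring (by omega) (by omega) hG hcL hc hcount
  have hθ : thetaTilde r G ≤ 16 * L ^ 2 * s := Nat.sInf_le ⟨2 * s, by omega, hrep⟩
  calc (thetaTilde r G : ℝ) ≤ 16 * L ^ 2 * s := by exact_mod_cast hθ
    _ ≤ 16 * L ^ 2 * (4 * L * Real.log n) := by
      gcongr
      exact hs2.trans (by gcongr)
    _ = 64 * (L : ℝ) ^ 3 * Real.log n := by ring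
end

section
/- Let G be a linear r-uniform hypergraph whose edge set is partitioned into matchings M_1, …, M_L, and let {v_1,…,v_r} be an r-set of vertices that is not an edge of G. For i ∈ [L], let a_i denote the number of edges e ∈ M_i with e ∩ {v_1,…,v_r} ≠ ∅, and let I_2 be the set of those i ∈ [L] such that {v_1,…,v_r} is contained in the union of the edges of M_i. Then for all but at most C(r,2) = r(r−1)/2 indices i ∈ I_2 we have a_i = r. -/
/-- If every vertex of `s` lies in an edge of the matching `M` and the number of edges of `M`
meeting `s` differs from `s.card`, then some edge of `M` contains two vertices of `s`. -/
theorem exists_pair_subset_of_card_meeting_ne {V : Type*} [DecidableEq V]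
    {M : Finset (Finset V)} (hM : ∀ e ∈ M, ∀ f ∈ M, e ≠ f → Disjoint e f)
    {s : Finset V} (hcover : ∀ v ∈ s, ∃ f ∈ M, v ∈ f)
    (hcard : (M.filter fun f => (s ∩ f).Nonempty).card ≠ s.card) :
    ∃ p ∈ s.powersetCard 2, ∃ f ∈ M, p ⊆ f := by
  choose! g hgM hg using hcover
  by_contra! h
  refine hcard (Finset.card_bij (fun v _ => g v) (fun v hv => ?_) (fun u hu v hv huv => ?_)
    (fun f hf => ?_)).symm
  · exact Finset.mem_filter.2 ⟨hgM v hv, v, Finset.mem_inter.2 ⟨hv, hg v hv⟩⟩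
  · by_contra hne
    refine h {u, v} (Finset.mem_powersetCard.2 ⟨?_, Finset.card_pair hne⟩) (g u) (hgM u hu) ?_
    · simp [Finset.insert_subset_iff, hu, hv]
    · refine Finset.insert_subset (hg u hu) (Finset.singleton_subset_iff.2 ?_)
      exact (show g u = g v from huv) ▸ hg v hv
  · obtain ⟨hfM, v, hv⟩ := Finset.mem_filter.1 hf
    obtain ⟨hvs, hvf⟩ := Finset.mem_inter.1 hv
    refine ⟨v, hvs, ?_⟩
    by_contra hne
    exact Finset.disjoint_left.1 (hM _ (hgM v hvs) f hfM hne) (hg v hvs) hvf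

/-- In a linear hypergraph, a pair of vertices is contained in at most one edge. -/
theorem IsLinear.eq_of_pair_subset {V : Type*} [DecidableEq V] {G : Finset (Finset V)}
    (hG : IsLinear G) {e f p : Finset V} (he : e ∈ G) (hf : f ∈ G) (hp : p.card = 2)
    (hpe : p ⊆ e) (hpf : p ⊆ f) : e = f := by
  by_contra hne
  have := Finset.card_le_card (Finset.subset_inter hpe hpf)
  have := hG e he f hf hne
  omega

/-- **Linear case: almost all covering matchings meet a non-edge in exactly `r` edges.**
Let `G` be a linear `r`-uniform hypergraph whose edge set is partitioned into matchings
`M 1, …, M L`, and let `e₀` be an `r`-set of vertices that is not an edge of `G`.  For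
`i ∈ [L]` let `a_i` be the number of edges of `M i` meeting `e₀`, and let `I₂` be the set
of indices `i` for which `e₀` is contained in the union of the edges of `M i`.  Then the
number of `i ∈ I₂` with `a_i ≠ r` is at most `C(r,2) = r(r−1)/2`. -/
theorem linear_few_bad_matchings
    {V : Type*} [DecidableEq V] (r L : ℕ)
    (G : Finset (Finset V)) (hunif : ∀ e ∈ G, e.card = r) (hlin : IsLinear G)
    (M : Fin L → Finset (Finset V))
    (hmatch : ∀ i : Fin L, ∀ e ∈ M i, ∀ f ∈ M i, e ≠ f → Disjoint e f)
    (hpart : ∀ e : Finset V, e ∈ G ↔ ∃ i : Fin L, e ∈ M i)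
    (hdisj : ∀ i j : Fin L, i ≠ j → Disjoint (M i) (M j))
    (e₀ : Finset V) (hcard : e₀.card = r) (hne : e₀ ∉ G) :
    (Finset.univ.filter fun i : Fin L =>
        (∀ v ∈ e₀, ∃ f ∈ M i, v ∈ f) ∧
        ((M i).filter fun f => (e₀ ∩ f).Nonempty).card ≠ r).card ≤ r.choose 2 := by
  classical
  have hpair : ∀ i ∈ Finset.univ.filter fun i : Fin L =>
        (∀ v ∈ e₀, ∃ f ∈ M i, v ∈ f) ∧
        ((M i).filter fun f => (e₀ ∩ f).Nonempty).card ≠ r,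
      ∃ p ∈ e₀.powersetCard 2, ∃ f ∈ M i, p ⊆ f := by
    intro i hi
    obtain ⟨hcover, hai⟩ := (Finset.mem_filter.1 hi).2
    exact exists_pair_subset_of_card_meeting_ne (hmatch i) hcover (hcard ▸ hai)
  choose! p hp f hf hpf using hpair
  rw [← hcard, ← Finset.card_powersetCard]
  refine Finset.card_le_card_of_injOn p (fun i hi => hp i (hcard ▸ hi)) fun i hi j hj hij => ?_
  rw [hcard] at hi hj
  have hfij : f i = f j := hlin.eq_of_pair_subset ((hpart _).2 ⟨i, hf i hi⟩)
    ((hpart _).2 ⟨j, hf j hj⟩) (Finset.mem_powersetCard.1 (hp i hi)).2 (hpf i hi)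
    (hij ▸ hpf j hj)
  by_contra hne
  exact Finset.disjoint_left.1 (hdisj i j hne) (hf i hi) (hfij ▸ hf j hj)
end

section
/- For every integer r ≥ 3 there exists an integer n₀ = n₀(r) such that for every n ≥ n₀ and every integer Δ with 1 ≤ Δ ≤ n, the number of r-uniform hypergraphs on vertex set [n] with maximum degree at most Δ satisfies log |𝓗^(r)(n,Δ)| > (Δ·n/4) · log n. -/
/-- An `r`-uniform hypergraph on `[n]` with maximum degree at most `Δ`
(a member of `𝓗^(r)(n,Δ)`). -/
def IsBoundedDegHypergraph (r n Δ : ℕ) (G : Finset (Finset (Fin n))) : Prop :=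
  (∀ e ∈ G, e.card = r) ∧ ∀ v : Fin n, hyperDegree G v ≤ Δ

/-- The edge `{ι (k, w k) : k}` selected by `w` from the parts `ι (k, ·)`. -/
def transversalEdge {V : Type*} [DecidableEq V] {r m : ℕ} (ι : Fin r × Fin m ↪ V)
    (w : Fin r → Fin m) : Finset V :=
  Finset.univ.image fun k => ι (k, w k)

lemma mem_transversalEdge {V : Type*} [DecidableEq V] {r m : ℕ} (ι : Fin r × Fin m ↪ V)
    (w : Fin r → Fin m) (k : Fin r) (x : Fin m) :
    ι (k, x) ∈ transversalEdge ι w ↔ w k = x := by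
  simp [transversalEdge]

lemma card_transversalEdge {V : Type*} [DecidableEq V] {r m : ℕ} (ι : Fin r × Fin m ↪ V)
    (w : Fin r → Fin m) : (transversalEdge ι w).card = r := by
  rw [transversalEdge, Finset.card_image_of_injective, Finset.card_univ, Fintype.card_fin]
  intro a b h
  exact congrArg Prod.fst (ι.injective h)

lemma transversalEdge_injective {V : Type*} [DecidableEq V] {r m : ℕ} (ι : Fin r × Fin m ↪ V) :
    Function.Injective (transversalEdge ι) := by
  intro w w' h
  funext k
  have := (mem_transversalEdge ι w k (w k)).2 rfl
  rw [h, mem_transversalEdge] at this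
  exact this.symm

/-- The union of the `Δ` matchings of transversal edges given by the tuples of permutations
`σ j`. -/
def matchingUnion {V : Type*} [DecidableEq V] {r m Δ : ℕ} (ι : Fin r × Fin m ↪ V)
    (σ : Fin Δ → Fin r → Equiv.Perm (Fin m)) : Finset (Finset V) :=
  Finset.univ.image fun p : Fin Δ × Fin m => transversalEdge ι fun k => σ p.1 k p.2

lemma card_matchingUnion_le {V : Type*} [DecidableEq V] {r m Δ : ℕ} (ι : Fin r × Fin m ↪ V)
    (σ : Fin Δ → Fin r → Equiv.Perm (Fin m)) : (matchingUnion ι σ).card ≤ Δ * m := by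
  refine Finset.card_image_le.trans ?_
  simp

lemma hyperDegree_matchingUnion_le {V : Type*} [DecidableEq V] {r m Δ : ℕ}
    (ι : Fin r × Fin m ↪ V) (σ : Fin Δ → Fin r → Equiv.Perm (Fin m)) (v : V) :
    hyperDegree (matchingUnion ι σ) v ≤ Δ := by
  unfold hyperDegree
  by_cases hv : ∃ p, ι p = v
  · obtain ⟨⟨k, x⟩, rfl⟩ := hv
    have hsub : ((matchingUnion ι σ).filter fun e => ι (k, x) ∈ e) ⊆
        Finset.univ.image fun j : Fin Δ =>
          transversalEdge ι fun l => σ j l ((σ j k).symm x) := by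
      intro e he
      obtain ⟨he, hx⟩ := Finset.mem_filter.1 he
      obtain ⟨⟨j, i⟩, -, rfl⟩ := Finset.mem_image.1 he
      rw [mem_transversalEdge] at hx
      refine Finset.mem_image.2 ⟨j, Finset.mem_univ _, ?_⟩
      rw [← hx, Equiv.symm_apply_apply]
    refine (Finset.card_le_card hsub).trans (Finset.card_image_le.trans ?_)
    simp
  · rw [Finset.card_eq_zero.2]
    · exact Nat.zero_le _
    · refine Finset.filter_eq_empty_iff.2 fun e he hve => hv ?_
      obtain ⟨p, -, rfl⟩ := Finset.mem_image.1 he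
      obtain ⟨k, -, hk⟩ := Finset.mem_image.1 hve
      exact ⟨_, hk⟩

lemma isBoundedDegHypergraph_matchingUnion {r m n Δ : ℕ} (ι : Fin r × Fin m ↪ Fin n)
    (σ : Fin Δ → Fin r → Equiv.Perm (Fin m)) :
    IsBoundedDegHypergraph r n Δ (matchingUnion ι σ) := by
  refine ⟨fun e he => ?_, hyperDegree_matchingUnion_le ι σ⟩
  obtain ⟨p, -, rfl⟩ := Finset.mem_image.1 he
  exact card_transversalEdge ι _

lemma card_matchingUnion_fiber_le {V : Type*} [DecidableEq V] {r m Δ : ℕ}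
    (ι : Fin r × Fin m ↪ V) (G : Finset (Finset V)) :
    (Finset.univ.filter fun σ : Fin Δ → Fin r → Equiv.Perm (Fin m) =>
      matchingUnion ι σ = G).card ≤ (Δ * m) ^ (Δ * m) := by
  rcases Finset.eq_empty_or_nonempty (Finset.univ.filter
    fun σ : Fin Δ → Fin r → Equiv.Perm (Fin m) => matchingUnion ι σ = G) with h | ⟨σ₀, hσ₀⟩
  · rw [h]
    exact Nat.zero_le _
  have hG : G.card ≤ Δ * m := by
    rw [← (Finset.mem_filter.1 hσ₀).2]
    exact card_matchingUnion_le ι σ₀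
  calc
    _ ≤ (Fintype.piFinset fun _ : Fin Δ × Fin m => G).card := by
      refine Finset.card_le_card_of_injOn
        (fun σ p => transversalEdge ι fun k => σ p.1 k p.2) ?_ ?_
      · intro σ hσ
        have hσ' : matchingUnion ι σ = G := by simpa using hσ
        refine Finset.mem_coe.2 (Fintype.mem_piFinset.2 fun p => ?_)
        rw [← hσ']
        exact Finset.mem_image_of_mem _ (Finset.mem_univ p)
      · intro σ _ τ _ h
        funext j k
        ext1 i
        exact congrFun (transversalEdge_injective ι (congrFun h (j, i))) k
    _ = G.card ^ (Δ * m) := by simp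
    _ ≤ _ := Nat.pow_le_pow_left hG _

lemma factorial_pow_le_card_boundedDegHypergraphs {r m n : ℕ} (Δ : ℕ) (h : r * m ≤ n) :
    (m.factorial ^ r) ^ Δ ≤ (Δ * m) ^ (Δ * m) *
      Nat.card {G : Finset (Finset (Fin n)) // IsBoundedDegHypergraph r n Δ G} := by
  classical
  obtain ⟨ι⟩ : Nonempty (Fin r × Fin m ↪ Fin n) :=
    Function.Embedding.nonempty_of_card_le (by simpa using h)
  have key := Finset.card_le_mul_card_image_of_maps_to
    (s := (Finset.univ : Finset (Fin Δ → Fin r → Equiv.Perm (Fin m))))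
    (f := matchingUnion ι) (t := Finset.univ.filter (IsBoundedDegHypergraph r n Δ))
    (fun σ _ => Finset.mem_filter.2
      ⟨Finset.mem_univ _, isBoundedDegHypergraph_matchingUnion ι σ⟩)
    ((Δ * m) ^ (Δ * m)) (fun G _ => card_matchingUnion_fiber_le ι G)
  rw [Nat.card_eq_fintype_card, Fintype.card_subtype]
  simpa [Fintype.card_perm] using key

lemma mul_log_sub_le_log_factorial (m : ℕ) :
    (m : ℝ) * Real.log m - m ≤ Real.log m.factorial := by
  rcases Nat.eq_zero_or_pos m with rfl | hm
  · simp
  have hm' : (0 : ℝ) < m := by exact_mod_cast hm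
  have hf : (0 : ℝ) < m.factorial := by exact_mod_cast m.factorial_pos
  have h := Real.log_le_log (by positivity) (Real.pow_div_factorial_le_exp (m : ℝ) hm'.le m)
  rw [Real.log_exp, Real.log_div (by positivity) hf.ne', Real.log_pow] at h
  linarith

lemma le_log_card_boundedDegHypergraphs {r m n Δ : ℕ} (h : r * m ≤ n) (hm : 1 ≤ m)
    (hΔ : 1 ≤ Δ) :
    (Δ : ℝ) * (m * ((r - 1) * Real.log m - r - Real.log Δ)) ≤
      Real.log (Nat.card {G : Finset (Finset (Fin n)) // IsBoundedDegHypergraph r n Δ G}) := by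
  have key := factorial_pow_le_card_boundedDegHypergraphs Δ h
  set N := Nat.card {G : Finset (Finset (Fin n)) // IsBoundedDegHypergraph r n Δ G}
  have hN : N ≠ 0 := by
    intro h0
    rw [h0, mul_zero] at key
    exact (pow_pos (pow_pos m.factorial_pos r) Δ).not_ge key
  have hN' : (N : ℝ) ≠ 0 := by exact_mod_cast hN
  have hm' : (0 : ℝ) < m := by exact_mod_cast hm
  have hΔ' : (0 : ℝ) < Δ := by exact_mod_cast hΔ
  have hf : (0 : ℝ) < m.factorial := by exact_mod_cast m.factorial_pos
  have key' : ((m.factorial : ℝ) ^ r) ^ Δ ≤ ((Δ : ℝ) * m) ^ (Δ * m) * N := by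
    exact_mod_cast key
  have hlog := Real.log_le_log (by positivity) key'
  rw [Real.log_mul (by positivity) hN', Real.log_pow, Real.log_pow, Real.log_pow,
    Real.log_mul hΔ'.ne' hm'.ne'] at hlog
  push_cast at hlog
  have hfac := mul_le_mul_of_nonneg_left (mul_log_sub_le_log_factorial m)
    (show (0 : ℝ) ≤ Δ * r by positivity)
  linarith

/-- **Counting bounded degree hypergraphs.** For every `r ≥ 3` there exists `n₀ = n₀(r)`
such that for every `n ≥ n₀` and every `Δ` with `1 ≤ Δ ≤ n`,
`log |𝓗^(r)(n,Δ)| > (Δ·n/4) · log n`. -/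
theorem log_card_boundedDegHypergraphs_gt :
    ∀ r : ℕ, 3 ≤ r →
      ∃ n₀ : ℕ, ∀ n : ℕ, n₀ ≤ n → ∀ Δ : ℕ, 1 ≤ Δ → Δ ≤ n →
        ((Δ : ℝ) * n / 4) * Real.log n <
          Real.log (Nat.card {G : Finset (Finset (Fin n)) // IsBoundedDegHypergraph r n Δ G}) := by
  intro r hr
  have hr' : (3 : ℝ) ≤ r := by exact_mod_cast hr
  set C : ℝ := r + (r - 1) * Real.log (2 * r) with hC
  obtain ⟨n₁, hn₁⟩ := Filter.eventually_atTop.1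
    ((Real.tendsto_log_atTop.comp tendsto_natCast_atTop_atTop).eventually_ge_atTop (24 * C))
  refine ⟨max n₁ (10 * r), fun n hn Δ hΔ hΔn => ?_⟩
  have hnC : 24 * C ≤ Real.log n := hn₁ n (le_of_max_le_left hn)
  have hnr : 10 * r ≤ n := le_of_max_le_right hn
  have hnr' : (10 : ℝ) * r ≤ n := by exact_mod_cast hnr
  have hn0 : (0 : ℝ) < n := by linarith
  have hΔ' : (0 : ℝ) < Δ := by exact_mod_cast hΔ
  have hm : 1 ≤ n / r := (Nat.one_le_div_iff (by lia)).2 (by lia)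
  refine lt_of_lt_of_le ?_
    (le_log_card_boundedDegHypergraphs (Nat.mul_div_le n r) hm hΔ)
  set m := n / r
  have hrm : (n : ℝ) < r * m + r := by
    have := Nat.lt_mul_div_succ n (show 0 < r by lia)
    rw [mul_add, mul_one] at this
    exact_mod_cast this
  have hlogΔ : Real.log Δ ≤ Real.log n := Real.log_le_log hΔ' (by exact_mod_cast hΔn)
  have hlogm : Real.log n - Real.log (2 * r) ≤ Real.log m := by
    rw [← Real.log_div hn0.ne' (by positivity)]
    refine Real.log_le_log (by positivity) ?_
    rw [div_le_iff₀ (by positivity)]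
    linarith
  have hC0 : 0 < C := by
    have : 0 ≤ Real.log (2 * r) := Real.log_nonneg (by linarith)
    have : 0 ≤ (r - 1) * Real.log (2 * r) := mul_nonneg (by linarith) this
    linarith
  set L := Real.log n
  have hL : 0 < L := by linarith
  have hbracket : (r : ℝ) * (7 / 24 * L) ≤ (r - 1) * Real.log m - r - Real.log Δ := by
    have h1 := mul_le_mul_of_nonneg_left hlogm (show (0 : ℝ) ≤ r - 1 by linarith)
    have h2 : 0 ≤ (r - 3) * L := mul_nonneg (by linarith) hL.le
    nlinarith
  rw [mul_div_assoc, mul_assoc]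
  refine mul_lt_mul_of_pos_left ?_ hΔ'
  calc
    (n : ℝ) / 4 * L < (r * m) * (7 / 24 * L) := by nlinarith
    _ = m * (r * (7 / 24 * L)) := by ring
    _ ≤ _ := mul_le_mul_of_nonneg_left hbracket (Nat.cast_nonneg m)
end
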